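/- arXiv:1110.4660 — 4 statements merged into one kernel-verified Lean document; each statement's English description precedes it below -/
import Mathlib

section
/- Let d ≥ 1, let G be a multigraph on a finite vertex set V with |V| = n and edge set E, and let k_v′ ≥ 0 be integers assigned to the vertices, with |E| = d(n−1) + Σ_{v∈V} k_v′ + binom(d+1,2). Then |F| ≤ d(n_F − ω_F) + Σ_{v ∈ V_F} k_v′ + binom(d+1,2) for every nonempty F ⊆ E if and only if E can be partitioned as E = E₁ ⊔ E₂ ⊔ E₃ where: E₁ is a disjoint union of d spanning trees of G; E₂ satisfies |E₂| = Σ_{v∈V} k_v′ and |F| ≤ Σ_{v ∈ V_F} k_v′ for every F ⊆ E₂; and |E₃| = binom(d+1,2). (Combinatorial decomposition underlying the mixed plate-and-bar characterization, via matroid union.) -/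
/-- The set `V_F` of vertices incident to some edge of `F`. -/
def incVerts {V E : Type*} [DecidableEq V] (tail head : E → V) (F : Finset E) :
    Finset V :=
  F.image tail ∪ F.image head

/-- Two vertices are adjacent through `F` if some edge of `F` joins them. -/
def adjRel {V E : Type*} (tail head : E → V) (F : Finset E) (u v : V) : Prop :=
  ∃ e ∈ F, (tail e = u ∧ head e = v) ∨ (tail e = v ∧ head e = u)

/-- `ω_F`: the number of connected components of the graph `(V_F, F)`. -/
noncomputable def numComp {V E : Type*} [DecidableEq V] (tail head : E → V)
    (F : Finset E) : ℕ :=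
  Nat.card (Quot fun u v : {x : V // x ∈ incVerts tail head F} =>
    adjRel tail head F u.1 v.1)

/-- `T` is a spanning tree: `|T| = |V| − 1` and `(V, T)` is connected. -/
def IsSpanningTree {V E : Type*} [Fintype V] (tail head : E → V) (T : Finset E) : Prop :=
  T.card + 1 = Fintype.card V ∧ ∀ u v : V, Relation.EqvGen (adjRel tail head T) u v

/-- Integer polymatroid rank functions. -/
structure IsPmRank {E : Type*} [DecidableEq E] (f : Finset E → ℕ) : Prop where
  zero : f ∅ = 0
  mono : ∀ A B, A ⊆ B → f A ≤ f B
  sub : ∀ A B, f (A ∪ B) + f (A ∩ B) ≤ f A + f B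

theorem IsPmRank.add {E : Type*} [DecidableEq E] {f g : Finset E → ℕ} (hf : IsPmRank f)
    (hg : IsPmRank g) : IsPmRank (fun F => f F + g F) where
  zero := by simp [hf.zero, hg.zero]
  mono A B h := Nat.add_le_add (hf.mono A B h) (hg.mono A B h)
  sub A B := by
    have := hf.sub A B
    have := hg.sub A B
    omega

theorem IsPmRank.nsmul {E : Type*} [DecidableEq E] {f : Finset E → ℕ} (hf : IsPmRank f) (d : ℕ) :
    IsPmRank (fun F => d * f F) where
  zero := by simp [hf.zero]
  mono A B h := Nat.mul_le_mul_left _ (hf.mono A B h)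
  sub A B := by
    have := Nat.mul_le_mul_left d (hf.sub A B)
    linarith

theorem split_aux {E : Type*} [DecidableEq E] {f g : Finset E → ℕ} (hf : IsPmRank f)
    (hg : IsPmRank g) (S : Finset E) : ∀ (m : ℕ) (X Y : Finset E), (X ∩ Y).card = m →
    X ⊆ S → Y ⊆ S →
    (∀ F ⊆ S, F.card ≤ f (F ∩ X) + g (F ∩ Y)) →
    ∃ A B : Finset E, Disjoint A B ∧ A ⊆ S ∧ B ⊆ S ∧
      (∀ F ⊆ S, F.card ≤ f (F ∩ A) + g (F ∩ B)) := by
  intro m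
  induction m with
  | zero =>
    intro X Y h0 hX hY h
    exact ⟨X, Y, by rw [Finset.disjoint_iff_inter_eq_empty]; simpa using h0, hX, hY, h⟩
  | succ m ih =>
    intro X Y h0 hX hY h
    obtain ⟨e, he⟩ : (X ∩ Y).Nonempty := by
      rw [← Finset.card_pos]; omega
    have heX := (Finset.mem_inter.1 he).1
    have heY := (Finset.mem_inter.1 he).2
    have hc : ((X ∩ Y).erase e).card = m := by
      rw [Finset.card_erase_of_mem he]; omega
    by_cases h1 : ∀ F ⊆ S, F.card ≤ f (F ∩ X.erase e) + g (F ∩ Y)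
    · refine ih (X.erase e) Y ?_ ((Finset.erase_subset _ _).trans hX) hY h1
      rw [← hc]; congr 1; ext x; simp
    by_cases h2 : ∀ F ⊆ S, F.card ≤ f (F ∩ X) + g (F ∩ Y.erase e)
    · refine ih X (Y.erase e) ?_ hX ((Finset.erase_subset _ _).trans hY) h2
      rw [← hc]; congr 1; ext x; simp; tauto
    exfalso
    push Not at h1 h2
    obtain ⟨F, hF, h1⟩ := h1
    obtain ⟨G, hG, h2⟩ := h2
    have heF : e ∈ F := by
      by_contra hn
      have : F ∩ X.erase e = F ∩ X := by
        ext x; simp; rintro hx - rfl; exact hn hx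
      rw [this] at h1
      exact absurd (h F hF) (by omega)
    have heG : e ∈ G := by
      by_contra hn
      have : G ∩ Y.erase e = G ∩ Y := by
        ext x; simp; rintro hx - rfl; exact hn hx
      rw [this] at h2
      exact absurd (h G hG) (by omega)
    have a1 := hf.sub (F ∩ X.erase e) (G ∩ X)
    have a2 := hg.sub (F ∩ Y) (G ∩ Y.erase e)
    have b1 := hf.mono ((F ∪ G) ∩ X) (F ∩ X.erase e ∪ G ∩ X) (by
      intro x; simp; by_cases x = e <;> simp_all <;> tauto)
    have b2 := hg.mono ((F ∪ G) ∩ Y) (F ∩ Y ∪ G ∩ Y.erase e) (by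
      intro x; simp; by_cases x = e <;> simp_all <;> tauto)
    have b3 := hf.mono ((F ∩ G).erase e ∩ X) (F ∩ X.erase e ∩ (G ∩ X)) (by
      intro x; simp; tauto)
    have b4 := hg.mono ((F ∩ G).erase e ∩ Y) (F ∩ Y ∩ (G ∩ Y.erase e)) (by
      intro x; simp; tauto)
    have c1 := h (F ∪ G) (Finset.union_subset hF hG)
    have c2 := h ((F ∩ G).erase e)
      ((Finset.erase_subset _ _).trans (Finset.inter_subset_left.trans hF))
    have c3 := Finset.card_union_add_card_inter F G
    have c4 := Finset.card_erase_add_one (Finset.mem_inter.2 ⟨heF, heG⟩)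
    omega

/-- Two-function partition theorem. -/
theorem split {E : Type*} [DecidableEq E] {f g : Finset E → ℕ} (hf : IsPmRank f)
    (hg : IsPmRank g) (S : Finset E) (h : ∀ F ⊆ S, F.card ≤ f F + g F) :
    ∃ A B : Finset E, Disjoint A B ∧ A ∪ B = S ∧ (∀ F ⊆ A, F.card ≤ f F) ∧
      (∀ F ⊆ B, F.card ≤ g F) := by
  obtain ⟨A, B, hd, hA, hB, hh⟩ := split_aux hf hg S _ S S rfl subset_rfl subset_rfl (by
    intro F hF
    rw [Finset.inter_eq_left.2 hF]; exact h F hF)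
  refine ⟨A, B, hd, ?_, ?_, ?_⟩
  · apply (Finset.union_subset hA hB).antisymm
    intro x hx
    by_contra hn
    have := hh {x} (by simpa using hx)
    simp at hn
    rw [Finset.singleton_inter_of_notMem hn.1, Finset.singleton_inter_of_notMem hn.2, hf.zero,
      hg.zero] at this
    simp at this
  · intro F hF
    have := hh F (hF.trans hA)
    rwa [Finset.inter_eq_left.2 hF, Finset.disjoint_iff_inter_eq_empty.1
      (Finset.disjoint_of_subset_left hF hd), hg.zero] at this
  · intro F hF
    have := hh F (hF.trans hB)
    rwa [Finset.inter_eq_left.2 hF, Finset.disjoint_iff_inter_eq_empty.1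
      (Finset.disjoint_of_subset_left hF hd.symm), hf.zero, zero_add] at this

theorem split_many {E : Type*} [DecidableEq E] {f g : Finset E → ℕ} (hf : IsPmRank f)
    (hg : IsPmRank g) : ∀ (d : ℕ) (S : Finset E), (∀ F ⊆ S, F.card ≤ d * f F + g F) →
    ∃ (T : Fin d → Finset E) (B : Finset E), (∀ i j, i ≠ j → Disjoint (T i) (T j)) ∧
      Disjoint (Finset.univ.biUnion T) B ∧ Finset.univ.biUnion T ∪ B = S ∧
      (∀ i, ∀ F ⊆ T i, F.card ≤ f F) ∧ (∀ F ⊆ B, F.card ≤ g F) := by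
  intro d
  induction d with
  | zero =>
    intro S h
    exact ⟨fun _ => ∅, S, fun i => i.elim0, by simp, by simp, fun i => i.elim0,
      by simpa using h⟩
  | succ d ih =>
    intro S h
    obtain ⟨A, S', hd, hU, hA, hB⟩ := split hf ((hf.nsmul d).add hg) S (by
      intro F hF
      have := h F hF
      linarith)
    obtain ⟨T, B, hT, hTB, hTU, h1, h2⟩ := ih S' hB
    have hTS : ∀ i, T i ⊆ S' := fun i => by
      rw [← hTU]
      exact (Finset.subset_biUnion_of_mem T (Finset.mem_univ i)).trans Finset.subset_union_left
    have hun : Finset.univ.biUnion (Fin.cons A T : Fin (d+1) → Finset E)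
        = A ∪ Finset.univ.biUnion T := by
      ext x; simp [Fin.exists_fin_succ]
    refine ⟨Fin.cons A T, B, ?_, ?_, ?_, ?_, h2⟩
    · intro i j
      refine Fin.cases ?_ (fun i => ?_) i <;> refine Fin.cases ?_ (fun j => ?_) j
      · simp
      · intro _; simpa using Finset.disjoint_of_subset_right (hTS j) hd
      · intro _; simpa using (Finset.disjoint_of_subset_right (hTS i) hd).symm
      · intro hij; simpa using hT i j (by rintro rfl; exact hij rfl)
    · rw [hun, Finset.disjoint_union_left]
      refine ⟨Finset.disjoint_of_subset_right ?_ hd, hTB⟩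
      rw [← hTU]; exact Finset.subset_union_right
    · rw [hun, Finset.union_assoc, hTU, hU]
    · intro i
      refine Fin.cases ?_ (fun i => ?_) i
      · simpa using hA
      · simpa using h1 i

/-- Functions constant along the edges of `F`. -/
def cocyc {V E : Type*} (tail head : E → V) (F : Finset E) : Submodule ℚ (V → ℚ) where
  carrier := {φ | ∀ e ∈ F, φ (tail e) = φ (head e)}
  add_mem' := by
    intro a b ha hb e he
    simp [ha e he, hb e he]
  zero_mem' := by intro e _; rfl
  smul_mem' := by
    intro c a ha e he
    simp [ha e he]

theorem mem_cocyc {V E : Type*} (tail head : E → V) (F : Finset E) (φ : V → ℚ) :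
    φ ∈ cocyc tail head F ↔ ∀ e ∈ F, φ (tail e) = φ (head e) := Iff.rfl

/-- dimension of `cocyc` -/
noncomputable def cdim {V E : Type*} (tail head : E → V) (F : Finset E) : ℕ :=
  Module.finrank ℚ (cocyc tail head F)

theorem cdim_le {V E : Type*} [Fintype V] (tail head : E → V) (F : Finset E) :
    cdim tail head F ≤ Fintype.card V := by
  have := Submodule.finrank_le (cocyc tail head F)
  rwa [Module.finrank_fintype_fun_eq_card] at this

theorem cdim_empty {V E : Type*} [Fintype V] (tail head : E → V) :
    cdim tail head ∅ = Fintype.card V := by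
  have : cocyc tail head ∅ = ⊤ := by ext φ; simp [mem_cocyc]
  rw [cdim, this, finrank_top, Module.finrank_fintype_fun_eq_card]

theorem cocyc_anti {V E : Type*} (tail head : E → V) {F G : Finset E} (h : F ⊆ G) :
    cocyc tail head G ≤ cocyc tail head F := fun _ hφ e he => hφ e (h he)

theorem cdim_super {V E : Type*} [Fintype V] [DecidableEq E] (tail head : E → V)
    (F G : Finset E) :
    cdim tail head F + cdim tail head G ≤ cdim tail head (F ∪ G) + cdim tail head (F ∩ G) := by
  have h := Submodule.finrank_sup_add_finrank_inf_eq (cocyc tail head F) (cocyc tail head G)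
  have h1 : cocyc tail head F ⊓ cocyc tail head G = cocyc tail head (F ∪ G) := by
    ext φ
    simp only [Submodule.mem_inf, mem_cocyc, Finset.mem_union]
    constructor
    · rintro ⟨a, b⟩ e (he | he)
      exacts [a e he, b e he]
    · intro a
      exact ⟨fun e he => a e (Or.inl he), fun e he => a e (Or.inr he)⟩
  have h2 := Submodule.finrank_mono (sup_le (cocyc_anti tail head (Finset.inter_subset_left : F ∩ G ⊆ F))
    (cocyc_anti tail head (Finset.inter_subset_right : F ∩ G ⊆ G)))
  rw [h1] at h
  unfold cdim
  omega

theorem cdim_single {V E : Type*} [Fintype V] (tail head : E → V) (e : E) :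
    Fintype.card V ≤ cdim tail head {e} + 1 := by
  let L : (V → ℚ) →ₗ[ℚ] ℚ := LinearMap.proj (R := ℚ) (φ := fun _ : V => ℚ) (tail e) -
    LinearMap.proj (R := ℚ) (φ := fun _ : V => ℚ) (head e)
  have h := LinearMap.finrank_range_add_finrank_ker L
  have h1 : LinearMap.ker L = cocyc tail head {e} := by
    ext φ; simp [mem_cocyc, L, sub_eq_zero]
  have h2 := Submodule.finrank_le (LinearMap.range L)
  rw [Module.finrank_self] at h2
  rw [h1, Module.finrank_fintype_fun_eq_card] at h
  unfold cdim
  omega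

theorem cdim_eq {V E : Type*} [Fintype V] (tail head : E → V) (F : Finset E) :
    cdim tail head F = Nat.card (Quot (adjRel tail head F)) := by
  classical
  haveI : Fintype (Quot (adjRel tail head F)) := Fintype.ofFinite _
  let Φ : (Quot (adjRel tail head F) → ℚ) ≃ₗ[ℚ] cocyc tail head F :=
    { toFun := fun ψ => ⟨fun v => ψ (Quot.mk _ v), fun e he =>
        congrArg ψ (Quot.sound ⟨e, he, Or.inl ⟨rfl, rfl⟩⟩)⟩
      map_add' := fun _ _ => rfl
      map_smul' := fun _ _ => rfl
      invFun := fun φ => Quot.lift φ.1 (by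
        rintro u v ⟨e, he, ⟨rfl, rfl⟩ | ⟨rfl, rfl⟩⟩
        exacts [φ.2 e he, (φ.2 e he).symm])
      left_inv := by
        intro ψ; funext q; induction q using Quot.ind; rfl
      right_inv := by intro φ; rfl }
  rw [cdim, ← Φ.finrank_eq, Module.finrank_fintype_fun_eq_card, Nat.card_eq_fintype_card]

theorem quot_card {V E : Type*} [Fintype V] [DecidableEq V] (tail head : E → V) (F : Finset E) :
    Nat.card (Quot (adjRel tail head F)) + (incVerts tail head F).card =
      numComp tail head F + Fintype.card V := by
  classical
  have hinc : ∀ {u v}, adjRel tail head F u v →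
      u ∈ incVerts tail head F ∧ v ∈ incVerts tail head F := by
    rintro u v ⟨e, he, ⟨rfl, rfl⟩ | ⟨rfl, rfl⟩⟩ <;>
    · simp only [incVerts, Finset.mem_union, Finset.mem_image]
      exact ⟨by first | exact Or.inl ⟨e, he, rfl⟩ | exact Or.inr ⟨e, he, rfl⟩,
        by first | exact Or.inl ⟨e, he, rfl⟩ | exact Or.inr ⟨e, he, rfl⟩⟩
  let W := {x : V // x ∈ incVerts tail head F}
  let R : W → W → Prop := fun u v => adjRel tail head F u.1 v.1
  let U := {x : V // ¬ x ∈ incVerts tail head F}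
  let Φ : Quot (adjRel tail head F) ≃ Quot R ⊕ U :=
    { toFun := Quot.lift (fun v => if h : v ∈ incVerts tail head F then
          Sum.inl (Quot.mk R ⟨v, h⟩) else Sum.inr ⟨v, h⟩) (by
        intro u v huv
        have hh := hinc huv
        simp only [hh.1, hh.2, dif_pos]
        exact congrArg _ (Quot.sound huv))
      invFun := Sum.elim (Quot.lift (fun w => Quot.mk _ w.1) (fun u v h => Quot.sound h))
        (fun u => Quot.mk _ u.1)
      left_inv := by
        intro q
        induction q using Quot.ind with | _ v =>
        by_cases h : v ∈ incVerts tail head F <;> simp [h]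
      right_inv := by
        rintro (q | u)
        · induction q using Quot.ind with | _ v =>
          have := v.2
          simp
        · have := u.2
          simp [this] }
  have h1 := Nat.card_congr Φ
  rw [Nat.card_sum] at h1
  have h2 : Nat.card (Quot R) = numComp tail head F := rfl
  have h3 : Nat.card U + (incVerts tail head F).card = Fintype.card V := by
    rw [Nat.card_eq_fintype_card, Fintype.card_subtype_compl, Fintype.card_coe]
    have := Finset.card_le_univ (incVerts tail head F)
    omega
  omega

/-- graphic rank -/
noncomputable def grank {V E : Type*} [Fintype V] (tail head : E → V) (F : Finset E) : ℕ :=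
  Fintype.card V - cdim tail head F

theorem grank_poly {V E : Type*} [Fintype V] [DecidableEq E] (tail head : E → V) :
    IsPmRank (grank tail head) where
  zero := by simp [grank, cdim_empty]
  mono A B h := Nat.sub_le_sub_left (Submodule.finrank_mono (cocyc_anti tail head h)) _
  sub A B := by
    have := cdim_super tail head A B
    have := cdim_le tail head A
    have := cdim_le tail head B
    have := cdim_le tail head (A ∪ B)
    have := cdim_le tail head (A ∩ B)
    unfold grank
    omega

theorem grank_eq {V E : Type*} [Fintype V] [DecidableEq V] (tail head : E → V) (F : Finset E) :
    (grank tail head F : ℤ) = (incVerts tail head F).card - numComp tail head F := by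
  have h1 := quot_card tail head F
  rw [← cdim_eq] at h1
  have := cdim_le tail head F
  unfold grank
  omega

theorem grank_union {V E : Type*} [Fintype V] [DecidableEq E] (tail head : E → V)
    (F A : Finset E) : grank tail head (F ∪ A) ≤ grank tail head F + A.card := by
  induction A using Finset.induction_on with
  | empty => simp
  | insert e A he ih =>
    have h1 := (grank_poly tail head).sub (F ∪ A) {e}
    have h2 := cdim_single tail head e
    have h3 : F ∪ insert e A = F ∪ A ∪ {e} := by ext; simp
    have h4 : grank tail head {e} ≤ 1 := by unfold grank; omega
    rw [h3, Finset.card_insert_of_notMem he]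
    omega

theorem tree_grank {V E : Type*} [Fintype V] [DecidableEq E] (tail head : E → V)
    {T : Finset E} (hT : IsSpanningTree tail head T) {F : Finset E} (hF : F ⊆ T) :
    F.card ≤ grank tail head F := by
  have h1 := grank_union tail head F (T \ F)
  rw [Finset.union_sdiff_of_subset hF] at h1
  have h2 := Finset.card_sdiff_add_card_eq_card hF
  have h3 : cdim tail head T ≤ 1 := by
    rw [cdim_eq]
    have : Subsingleton (Quot (adjRel tail head T)) := by
      constructor
      intro a b
      induction a using Quot.ind with | _ a =>
      induction b using Quot.ind with | _ b =>
      exact Quot.eqvGen_sound (hT.2 a b)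
    exact Finite.card_le_one_iff_subsingleton.2 inferInstance
  have h4 := hT.1
  unfold grank at *
  omega

theorem grank_lt {V E : Type*} [Fintype V] (tail head : E → V) (hn : 1 ≤ Fintype.card V)
    (F : Finset E) : grank tail head F + 1 ≤ Fintype.card V := by
  have : Nonempty V := Fintype.card_pos_iff.1 hn
  have : Nonempty (Quot (adjRel tail head F)) := ⟨Quot.mk _ (Classical.arbitrary V)⟩
  have : 0 < cdim tail head F := by rw [cdim_eq]; exact Nat.card_pos
  unfold grank
  omega

theorem tree_of {V E : Type*} [Fintype V] (tail head : E → V)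
    {T : Finset E} (h : T.card ≤ grank tail head T) (hc : T.card + 1 = Fintype.card V) :
    IsSpanningTree tail head T := by
  refine ⟨hc, fun u v => ?_⟩
  have h1 : cdim tail head T ≤ 1 := by
    have := cdim_le tail head T
    unfold grank at h; omega
  rw [cdim_eq] at h1
  have := Finite.card_le_one_iff_subsingleton.1 h1
  exact Quot.eqvGen_exact (Subsingleton.elim (Quot.mk (adjRel tail head T) u) (Quot.mk _ v))

theorem incVerts_mono {V E : Type*} [DecidableEq V] (tail head : E → V) {A B : Finset E}
    (h : A ⊆ B) : incVerts tail head A ⊆ incVerts tail head B :=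
  Finset.union_subset_union (Finset.image_subset_image h) (Finset.image_subset_image h)

theorem k_poly {V E : Type*} [DecidableEq V] [DecidableEq E] (tail head : E → V) (k' : V → ℕ) :
    IsPmRank (fun F => ∑ v ∈ incVerts tail head F, k' v) where
  zero := by simp [incVerts]
  mono A B h := Finset.sum_le_sum_of_subset (incVerts_mono tail head h)
  sub A B := by
    have h1 : incVerts tail head (A ∪ B) = incVerts tail head A ∪ incVerts tail head B := by
      simp only [incVerts, Finset.image_union]; exact Finset.union_union_union_comm _ _ _ _
    have h2 : incVerts tail head (A ∩ B) ⊆ incVerts tail head A ∩ incVerts tail head B :=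
      Finset.subset_inter (incVerts_mono tail head Finset.inter_subset_left)
        (incVerts_mono tail head Finset.inter_subset_right)
    have h3 := Finset.sum_le_sum_of_subset (f := k') h2
    have h4 := Finset.sum_union_inter (s₁ := incVerts tail head A)
      (s₂ := incVerts tail head B) (f := k')
    rw [h1]
    omega

theorem const_poly {E : Type*} [DecidableEq E] (D : ℕ) :
    IsPmRank (fun F : Finset E => if F = ∅ then 0 else D) where
  zero := by simp
  mono A B h := by
    by_cases hA : A = ∅
    · simp [hA]
    · have : B ≠ ∅ := by rintro rfl; exact hA (Finset.subset_empty.1 h)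
      simp [hA, this]
  sub A B := by
    by_cases hA : A = ∅
    · simp [hA]
    by_cases hB : B = ∅
    · simp [hB]
    have : A ∪ B ≠ ∅ := by simp [hA]
    simp only [hA, hB, this, if_false]
    split_ifs <;> omega

/-- combinatorial decomposition underlying the mixed plate-and-bar
characterization, via matroid union.  With `|E| = d(n−1) + Σ_v k_v' + C(d+1,2)`, the
count `|F| ≤ d(n_F − ω_F) + Σ_{v∈V_F} k_v' + C(d+1,2)` holds for every nonempty `F ⊆ E`
iff `E` partitions into `E₁ ⊔ E₂ ⊔ E₃` with `E₁` a disjoint union of `d` spanning trees,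
`|E₂| = Σ_v k_v'` with `|F| ≤ Σ_{v∈V_F} k_v'` for all `F ⊆ E₂`, and `|E₃| = C(d+1,2)`. -/
theorem stmt_14 {d : ℕ} (hd : 1 ≤ d) {V E : Type*} [Fintype V] [DecidableEq V]
    [Fintype E] [DecidableEq E] (tail head : E → V) (hn : 1 ≤ Fintype.card V)
    (k' : V → ℕ)
    (hE : Fintype.card E + d =
      d * Fintype.card V + (∑ v, k' v) + (d + 1).choose 2) :
    (∀ F : Finset E, F.Nonempty →
        (F.card : ℤ) ≤
          (d : ℤ) * ((incVerts tail head F).card - numComp tail head F)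
            + (∑ v ∈ incVerts tail head F, (k' v : ℤ)) + ((d + 1).choose 2 : ℤ))
      ↔ ∃ E₁ E₂ E₃ : Finset E,
          Disjoint E₁ E₂ ∧ Disjoint E₁ E₃ ∧ Disjoint E₂ E₃ ∧
          E₁ ∪ E₂ ∪ E₃ = Finset.univ ∧
          (∃ T : Fin d → Finset E, (∀ i, IsSpanningTree tail head (T i)) ∧
            (∀ i j, i ≠ j → Disjoint (T i) (T j)) ∧ Finset.univ.biUnion T = E₁) ∧
          (E₂.card = ∑ v, k' v ∧
            ∀ F ⊆ E₂, F.card ≤ ∑ v ∈ incVerts tail head F, k' v) ∧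
          E₃.card = (d + 1).choose 2 := by
  set D := (d + 1).choose 2 with hD
  constructor
  · intro h
    obtain ⟨T, B, hT, hTB, hTU, h1, h2⟩ := split_many (grank_poly tail head)
      ((k_poly tail head k').add (const_poly D)) d Finset.univ (by
        intro F _
        by_cases hF : F = ∅
        · simp [hF]
        have := h F (Finset.nonempty_iff_ne_empty.2 hF)
        rw [← grank_eq] at this
        simp only [hF, if_false]
        zify
        linarith)
    obtain ⟨E₂, E₃, hd2, hU2, hE2, hE3⟩ := split (k_poly tail head k') (const_poly D) B h2
    have c2 : E₂.card ≤ ∑ v, k' v := (hE2 E₂ subset_rfl).trans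
      (Finset.sum_le_sum_of_subset (Finset.subset_univ _))
    have c3 : E₃.card ≤ D := (hE3 E₃ subset_rfl).trans (by split_ifs <;> omega)
    have c1 : ∀ i, (T i).card + 1 ≤ Fintype.card V := fun i =>
      (Nat.add_le_add_right (h1 i _ subset_rfl) 1).trans (grank_lt tail head hn _)
    have e1 : (Finset.univ.biUnion T).card = ∑ i, (T i).card :=
      Finset.card_biUnion (fun i _ j _ hij => hT i j hij)
    have e2 : (Finset.univ.biUnion T).card + B.card = Fintype.card E := by
      rw [← Finset.card_union_of_disjoint hTB, hTU, Finset.card_univ]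
    have e3 : E₂.card + E₃.card = B.card := by
      rw [← Finset.card_union_of_disjoint hd2, hU2]
    have e4 : ∑ i, ((T i).card + 1) = ∑ i, (T i).card + d := by
      simp [Finset.sum_add_distrib]
    have e5 : ∑ _i : Fin d, Fintype.card V = d * Fintype.card V := by simp
    have e6 : ∑ i, ((T i).card + 1) ≤ ∑ _i : Fin d, Fintype.card V :=
      Finset.sum_le_sum (fun i _ => c1 i)
    have e7 : ∑ i, ((T i).card + 1) = ∑ _i : Fin d, Fintype.card V := by omega
    have e8 := (Finset.sum_eq_sum_iff_of_le (fun i _ => c1 i)).1 e7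
    have hB2 : E₂ ⊆ B := by rw [← hU2]; exact Finset.subset_union_left
    have hB3 : E₃ ⊆ B := by rw [← hU2]; exact Finset.subset_union_right
    refine ⟨Finset.univ.biUnion T, E₂, E₃, Finset.disjoint_of_subset_right hB2 hTB,
      Finset.disjoint_of_subset_right hB3 hTB, hd2, ?_, ⟨T, ?_, hT, rfl⟩, ⟨?_, hE2⟩, ?_⟩
    · rw [Finset.union_assoc, hU2, hTU]
    · intro i
      exact tree_of tail head (h1 i _ subset_rfl) (e8 i (Finset.mem_univ i))
    · omega
    · omega
  · rintro ⟨E₁, E₂, E₃, -, -, -, hU, ⟨T, hT, -, rfl⟩, ⟨-, hE2⟩, hE3⟩ F -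
    rw [← grank_eq]
    have s : F = (Finset.univ.biUnion fun i => F ∩ T i) ∪ (F ∩ E₂) ∪ (F ∩ E₃) := by
      rw [← Finset.inter_biUnion, ← Finset.inter_union_distrib_left,
        ← Finset.inter_union_distrib_left, hU, Finset.inter_univ]
    have a1 : (Finset.univ.biUnion fun i => F ∩ T i).card ≤ d * grank tail head F := by
      refine Finset.card_biUnion_le.trans ?_
      have : ∀ i ∈ (Finset.univ : Finset (Fin d)), (F ∩ T i).card ≤ grank tail head F :=
        fun i _ => (tree_grank tail head (hT i) Finset.inter_subset_right).trans
          ((grank_poly tail head).mono _ _ Finset.inter_subset_left)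
      simpa using Finset.sum_le_sum this
    have a2 : (F ∩ E₂).card ≤ ∑ v ∈ incVerts tail head F, k' v :=
      (hE2 _ Finset.inter_subset_right).trans
        ((k_poly tail head k').mono _ _ Finset.inter_subset_left)
    have a3 : (F ∩ E₃).card ≤ D := hE3 ▸ Finset.card_le_card Finset.inter_subset_right
    have a4 : F.card ≤ d * grank tail head F + ∑ v ∈ incVerts tail head F, k' v + D := by
      conv_lhs => rw [s]
      have b1 := Finset.card_union_le ((Finset.univ.biUnion fun i => F ∩ T i) ∪ (F ∩ E₂)) (F ∩ E₃)
      have b2 := Finset.card_union_le (Finset.univ.biUnion fun i => F ∩ T i) (F ∩ E₂)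
      omega
    exact_mod_cast a4
end

section
/- Fix d ≥ 1, a multigraph on vertex set V = {1,…,n} with edge set E (each edge with designated tail and head), and any presentation with lifting vectors c(e) ∈ ℤ^d. For F ⊆ E let Z(F) ⊆ ℝ^F denote the cycle space of F (the kernel of the linear map ℝ^F → ℝ^V sending the basis vector of e to 𝐞_{j(e)} − 𝐞_{i(e)}), let c(Z(F)) ⊆ ℝ^d denote its image under the map x ↦ Σ_{e∈F} x_e c(e), and set d_F = dim c(Z(F)) and, for each connected component F′ of the graph (V_F, F), d_{F′} = dim c(Z(F′)). Then for every nonempty F ⊆ E, the rank of the submatrix of the rigidity matrix formed by the rows indexed by F is at most d(n_F − ω_F) + binom(d,2)·n_F − Σ_{F′} binom(d − d_{F′}, 2) + binom(d_F + 1, 2), the sum being over the connected components F′ of (V_F, F). (Refined necessary sparsity condition in terms of the periodic graph (G,Γ).) -/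
open Matrix

/-- The space of unknowns (infinitesimal motions) of a `d`-periodic body-and-bar framework
with `n` body orbits: a translation vector `ṗ_v ∈ ℝ^d` for each vertex, an (unrestricted)
matrix `B_v` for each vertex whose skew-symmetrization `B_v - B_vᵀ` plays the role of the
skew-symmetric rotation unknown `A_v`, and a matrix `Λ̇`. -/
abbrev RigDom (d n : ℕ) :=
  (Fin n → Fin d → ℝ) × (Fin n → Matrix (Fin d) (Fin d) ℝ) × Matrix (Fin d) (Fin d) ℝ

/-- The edge vector `h(e) = Λ c(e) + q⁺(e) − q⁻(e)` of an edge. -/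
noncomputable def edgeVec {E : Type*} (d : ℕ)
    (Λ : Matrix (Fin d) (Fin d) ℝ) (c : E → Fin d → ℤ) (qm qp : E → Fin d → ℝ)
    (e : E) : Fin d → ℝ :=
  Λ.mulVec (fun r => (c e r : ℝ)) + qp e - qm e

/-- The value of the row of the rigidity matrix indexed by the edge `e`, evaluated at the
vector of unknowns `x`. -/
noncomputable def rowVal {E : Type*} (d n : ℕ) (tail head : E → Fin n)
    (Λ : Matrix (Fin d) (Fin d) ℝ) (c : E → Fin d → ℤ) (qm qp : E → Fin d → ℝ)
    (x : RigDom d n) (e : E) : ℝ :=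
  (x.2.2.mulVec (fun r => (c e r : ℝ))
      + (x.2.1 (head e) - (x.2.1 (head e))ᵀ).mulVec (qp e)
      - (x.2.1 (tail e) - (x.2.1 (tail e))ᵀ).mulVec (qm e)
      + x.1 (head e) - x.1 (tail e))
    ⬝ᵥ edgeVec d Λ c qm qp e

/-- The rank of the submatrix of the rigidity matrix formed by the rows indexed by `F`. -/
noncomputable def rigidityRank {E : Type*} (d n : ℕ) (tail head : E → Fin n)
    (Λ : Matrix (Fin d) (Fin d) ℝ) (c : E → Fin d → ℤ) (qm qp : E → Fin d → ℝ)
    (F : Finset E) : ℕ :=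
  Module.finrank ℝ (Submodule.span ℝ
    (Set.range fun x : RigDom d n => fun e : F => rowVal d n tail head Λ c qm qp x e.1))

/-- `c(Z(F))`: the image in `ℝ^d`, under `x ↦ Σ_{e∈F} x_e c(e)`, of the cycle space
`Z(F) ⊆ ℝ^F` (the kernel of the boundary map `ℝ^F → ℝ^V` sending the basis vector of `e`
to `𝐞_{head e} − 𝐞_{tail e}`). -/
def cycleImage {E : Type*} (d n : ℕ) (tail head : E → Fin n) (c : E → Fin d → ℤ)
    (F : Finset E) : Set (Fin d → ℝ) :=
  {y | ∃ x : E → ℝ, (∀ e ∉ F, x e = 0) ∧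
    (∀ v : Fin n,
      (∑ e ∈ F, x e * ((if head e = v then (1 : ℝ) else 0)
        - (if tail e = v then (1 : ℝ) else 0))) = 0) ∧
    y = fun r => ∑ e ∈ F, x e * (c e r : ℝ)}

/-- `d_F = dim c(Z(F))`. -/
noncomputable def cycleRank {E : Type*} (d n : ℕ) (tail head : E → Fin n)
    (c : E → Fin d → ℤ) (F : Finset E) : ℕ :=
  Module.finrank ℝ (Submodule.span ℝ (cycleImage d n tail head c F))

open scoped Classical in
/-- The connected components of the graph `(V_F, F)`, as a finite collection of edge
sets: the component of an edge `e ∈ F` consists of all edges of `F` whose endpoints are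
joined to those of `e` within `F`. -/
noncomputable def components {V E : Type*} [DecidableEq E] (tail head : E → V)
    (F : Finset E) : Finset (Finset E) :=
  F.image fun e =>
    F.filter fun e' => Relation.EqvGen (adjRel tail head F) (tail e) (tail e')


lemma rank_step {D X : Type*} [AddCommGroup D] [Module ℝ D] [FiniteDimensional ℝ D]
    [AddCommGroup X] [Module ℝ X] [FiniteDimensional ℝ X]
    (f : D →ₗ[ℝ] X) (R : Submodule ℝ X) (K : Submodule ℝ D) (hK : ∀ x ∈ K, f x ∈ R) :
    Module.finrank ℝ (R ⊔ LinearMap.range f : Submodule ℝ X) + Module.finrank ℝ K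
      ≤ Module.finrank ℝ R + Module.finrank ℝ D := by
  obtain ⟨C, hC⟩ := Submodule.exists_isCompl K
  have h1 : (R ⊔ LinearMap.range f) ≤ R ⊔ C.map f := by
    refine sup_le le_sup_left ?_
    rw [LinearMap.range_eq_map, ← hC.sup_eq_top, Submodule.map_sup]
    refine sup_le ?_ le_sup_right
    refine le_trans ?_ le_sup_left
    rintro _ ⟨x, hx, rfl⟩
    exact hK x hx
  have h2 := Submodule.finrank_mono h1
  have h3 := Submodule.finrank_add_le_finrank_add_finrank R (C.map f)
  have h4 := Submodule.finrank_map_le f C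
  have h5 := Submodule.finrank_add_eq_of_isCompl hC
  omega

/-- skew matrices -/
def Sk (m : ℕ) : Submodule ℝ (Matrix (Fin m) (Fin m) ℝ) where
  carrier := {A | Aᵀ = -A}
  add_mem' := by
    intro a b ha hb
    simp only [Set.mem_ofPred_eq] at *
    rw [transpose_add, ha, hb]; abel
  zero_mem' := by simp
  smul_mem' := by
    intro r a ha
    simp only [Set.mem_ofPred_eq] at *
    rw [transpose_smul, ha, smul_neg]

lemma card_lt_pairs (m : ℕ) :
    Fintype.card {p : Fin m × Fin m // p.1 < p.2} = m.choose 2 := by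
  have e : {p : Fin m × Fin m // p.1 < p.2} ≃ (j : Fin m) × Fin j.1 :=
    { toFun := fun p => ⟨p.1.2, ⟨p.1.1.1, p.2⟩⟩
      invFun := fun s => ⟨(⟨s.2.1, s.2.2.trans s.1.2⟩, s.1), s.2.2⟩
      left_inv := fun p => rfl
      right_inv := fun s => rfl }
  rw [Fintype.card_congr e, Fintype.card_sigma]
  simp only [Fintype.card_fin]
  rw [Fin.sum_univ_eq_sum_range (fun i => i) m, Finset.sum_range_id, Nat.choose_two_right]

lemma finrank_Sk (m : ℕ) : Module.finrank ℝ (Sk m) = m.choose 2 := by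
  let f : Sk m →ₗ[ℝ] ({p : Fin m × Fin m // p.1 < p.2} → ℝ) :=
    { toFun := fun A p => A.1 p.1.1 p.1.2
      map_add' := fun a b => rfl
      map_smul' := fun a b => rfl }
  have hskew : ∀ A : Sk m, ∀ i j, A.1 j i = - A.1 i j := by
    intro A i j
    have := congrFun (congrFun A.2 i) j
    simpa using this
  have hinj : Function.Injective f := by
    intro A B hAB
    ext i j
    have key : ∀ i j, i < j → A.1 i j = B.1 i j := fun i j h => congrFun hAB ⟨(i, j), h⟩
    rcases lt_trichotomy i j with h | h | h
    · exact key i j h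
    · subst h
      have h1 := hskew A i i
      have h2 := hskew B i i
      linarith
    · rw [hskew A j i, hskew B j i, key j i h]
  have hsurj : Function.Surjective f := by
    intro y
    refine ⟨⟨Matrix.of fun i j => if h : i < j then y ⟨(i, j), h⟩ else
      if h : j < i then - y ⟨(j, i), h⟩ else 0, ?_⟩, ?_⟩
    · change _ = _
      ext i j
      simp only [transpose_apply, of_apply]
      rcases lt_trichotomy i j with h | h | h
      · simp [h, h.not_gt]
      · subst h; simp
      · simp [h, h.not_gt]
    · ext ⟨⟨i, j⟩, h⟩
      change i < j at h
      change (if h : i < j then y ⟨(i, j), h⟩ else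
        if h : j < i then - y ⟨(j, i), h⟩ else 0) = _
      rw [dif_pos h]
  rw [(LinearEquiv.ofBijective f ⟨hinj, hsurj⟩).finrank_eq, Module.finrank_fintype_fun_eq_card,
    card_lt_pairs]

lemma onb_exists {d : ℕ} (U : Submodule ℝ (EuclideanSpace ℝ (Fin d))) (k : ℕ)
    (hk : Module.finrank ℝ U = k) :
    ∃ Q : Matrix (Fin d) (Fin k) ℝ, Qᵀ * Q = 1 ∧
      (∀ u ∈ U, Q *ᵥ (Qᵀ *ᵥ u.ofLp) = u.ofLp) ∧ ∀ j, WithLp.toLp 2 (Qᵀ j) ∈ U := by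
  subst hk
  let b := stdOrthonormalBasis ℝ U
  refine ⟨Matrix.of fun i j => (b j : EuclideanSpace ℝ (Fin d)) i, ?_, ?_, ?_⟩
  · ext i j
    have := orthonormal_iff_ite.1 b.orthonormal j i
    simp only [mul_apply, transpose_apply, of_apply, one_apply]
    simp only [Submodule.coe_inner, PiLp.inner_apply] at this
    simp only [eq_comm (a := i)]
    rw [← this]
    simp
  · intro u hu
    have := b.sum_repr' ⟨u, hu⟩
    have h2 := congrArg (fun x : U => (x : EuclideanSpace ℝ (Fin d)).ofLp) this
    simp only at h2
    ext i
    have h3 := congrFun h2 i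
    refine Eq.trans ?_ h3
    simp [mulVec, dotProduct, PiLp.inner_apply, mul_comm]
  · intro j
    exact (b j).2

lemma cobound {E : Type*} [DecidableEq E] {n : ℕ} (tail head : E → Fin n) (F : Finset E)
    (a : E → ℝ)
    (ha : ∀ x : E → ℝ, (∀ e ∉ F, x e = 0) →
    (∀ v : Fin n,
      (∑ e ∈ F, x e * ((if head e = v then (1 : ℝ) else 0)
        - (if tail e = v then (1 : ℝ) else 0))) = 0) → ∑ e ∈ F, x e * a e = 0) :
    ∃ p : Fin n → ℝ, ∀ e ∈ F, p (head e) - p (tail e) = a e := by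
  let f : (F → ℝ) →ₗ[ℝ] (Fin n → ℝ) := LinearMap.pi fun v =>
    ∑ e : F, ((if head e.1 = v then (1 : ℝ) else 0)
        - (if tail e.1 = v then (1 : ℝ) else 0)) • LinearMap.proj e
  let α : (F → ℝ) →ₗ[ℝ] ℝ := ∑ e : F, a e.1 • LinearMap.proj e
  have hα : α ∈ LinearMap.range f.dualMap := by
    rw [LinearMap.range_dualMap_eq_dualAnnihilator_ker, Submodule.mem_dualAnnihilator]
    intro x hx
    have := ha (fun e => if h : e ∈ F then x ⟨e, h⟩ else 0) (fun e h => by simp [h]) (by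
      intro v
      rw [← Finset.sum_coe_sort]
      have := congrFun hx v
      simp only [f, LinearMap.pi_apply, LinearMap.sum_apply, LinearMap.smul_apply,
        LinearMap.proj_apply, smul_eq_mul, Pi.zero_apply] at this
      refine Eq.trans ?_ this
      exact Finset.sum_congr rfl fun e _ => by simp [mul_comm])
    rw [← Finset.sum_coe_sort] at this
    rw [← this]
    simp only [α, LinearMap.sum_apply, LinearMap.smul_apply,
        LinearMap.proj_apply, smul_eq_mul]
    exact Finset.sum_congr rfl fun e _ => by simp [mul_comm]
  obtain ⟨φ, hφ⟩ := hα
  refine ⟨fun v => φ (Pi.single v 1), fun e he => ?_⟩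
  have h1 := LinearMap.congr_fun hφ (Pi.single ⟨e, he⟩ 1)
  have h2 : α (Pi.single ⟨e, he⟩ 1) = a e := by
    simp [α, Pi.single_apply]
  have h3 : f (Pi.single ⟨e, he⟩ 1) = Pi.single (head e) 1 - Pi.single (tail e) 1 := by
    ext v
    simp [f, Pi.single_apply, eq_comm]
  rw [h2, LinearMap.dualMap_apply, h3, map_sub] at h1
  exact h1

lemma finrank_skU {d k : ℕ} (U : Submodule ℝ (Fin d → ℝ)) (hk : Module.finrank ℝ U ≤ k) :
   ∃ S : Submodule ℝ (Matrix (Fin d) (Fin d) ℝ), S ≤ Sk d ∧ (∀ A ∈ S, ∀ u ∈ U, A *ᵥ u = 0) ∧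
    (d - k).choose 2 ≤ Module.finrank ℝ S := by
  let U' : Submodule ℝ (EuclideanSpace ℝ (Fin d)) :=
    U.map (WithLp.linearEquiv 2 ℝ (Fin d → ℝ)).symm.toLinearMap
  have hU' : Module.finrank ℝ U' = Module.finrank ℝ U := LinearEquiv.finrank_map_eq _ _
  have hc := Submodule.finrank_add_finrank_orthogonal U'
  rw [finrank_euclideanSpace_fin] at hc
  obtain ⟨Q, hQ1, hQ2, hQ3⟩ := onb_exists (U'ᗮ) _ rfl
  have hQU : ∀ u ∈ U, Qᵀ *ᵥ u = 0 := by
    intro u hu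
    ext j
    have := hQ3 j
    rw [Submodule.mem_orthogonal] at this
    have := this (WithLp.toLp 2 u) ⟨u, hu, rfl⟩
    simpa [PiLp.inner_apply, mulVec, dotProduct] using this
  let g : Matrix (Fin (Module.finrank ℝ U'ᗮ)) (Fin (Module.finrank ℝ U'ᗮ)) ℝ →ₗ[ℝ]
      Matrix (Fin d) (Fin d) ℝ :=
    { toFun := fun B => Q * B * Qᵀ
      map_add' := fun a b => by simp [Matrix.mul_add, Matrix.add_mul]
      map_smul' := fun a b => by simp }
  have hg : Function.Injective g := by
    have : Function.LeftInverse (fun A : Matrix (Fin d) (Fin d) ℝ => Qᵀ * A * Q) g := by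
      intro B
      change Qᵀ * (Q * B * Qᵀ) * Q = B
      calc _ = (Qᵀ * Q) * B * (Qᵀ * Q) := by simp only [Matrix.mul_assoc]
        _ = B := by simp [hQ1]
    exact this.injective
  refine ⟨(Sk _).map g, ?_, ?_, ?_⟩
  · rintro _ ⟨B, hB, rfl⟩
    change (Q * B * Qᵀ)ᵀ = - (Q * B * Qᵀ)
    have hB : Bᵀ = -B := hB
    simp [Matrix.transpose_mul, hB, Matrix.mul_assoc]
  · rintro _ ⟨B, hB, rfl⟩ u hu
    change (Q * B * Qᵀ) *ᵥ u = 0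
    rw [← Matrix.mulVec_mulVec, hQU u hu, Matrix.mulVec_zero]
  · rw [← LinearEquiv.finrank_eq (Submodule.equivMapOfInjective g hg _), finrank_Sk]
    apply Nat.choose_le_choose
    omega

lemma finrank_symU {d : ℕ} (U : Submodule ℝ (Fin d → ℝ)) :
   ∃ S : Submodule ℝ (Matrix (Fin d) (Fin d) ℝ),
    (∀ N ∈ S, ∃ A ∈ Sk d, ∀ u ∈ U, A *ᵥ u = N *ᵥ u) ∧
     d * d ≤ Module.finrank ℝ S + (Module.finrank ℝ U + 1).choose 2 := by
  let U' : Submodule ℝ (EuclideanSpace ℝ (Fin d)) :=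
    U.map (WithLp.linearEquiv 2 ℝ (Fin d → ℝ)).symm.toLinearMap
  have hU' : Module.finrank ℝ U' = Module.finrank ℝ U := LinearEquiv.finrank_map_eq _ _
  obtain ⟨Q, hQ1, hQ2, hQ3⟩ := onb_exists U' _ hU'
  let g : Matrix (Fin d) (Fin d) ℝ →ₗ[ℝ] (Sym2 (Fin (Module.finrank ℝ U)) → ℝ) :=
    { toFun := fun N s => (Qᵀ * (N + Nᵀ) * Q) s.out.1 s.out.2
      map_add' := fun a b => by
        ext s; simp [Matrix.mul_add, Matrix.add_mul]; ring
      map_smul' := fun a b => by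
        ext s; simp [Matrix.mul_add, Matrix.add_mul]; ring }
  refine ⟨LinearMap.ker g, ?_, ?_⟩
  · intro N hN
    have h0 : Qᵀ * (N + Nᵀ) * Q = 0 := by
      have hsym : (Qᵀ * (N + Nᵀ) * Q)ᵀ = Qᵀ * (N + Nᵀ) * Q := by
        simp [Matrix.transpose_mul, Matrix.mul_assoc, add_comm]
      ext i j
      have h1 : (Qᵀ * (N + Nᵀ) * Q) (s(i,j)).out.1 (s(i,j)).out.2 = 0 := congrFun hN s(i,j)
      have h2 : s((s(i,j)).out.1, (s(i,j)).out.2) = s(i,j) := Quot.out_eq s(i,j)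
      rcases Sym2.eq_iff.1 h2 with ⟨ha, hb⟩ | ⟨ha, hb⟩
      · rw [ha, hb] at h1; exact h1
      · rw [ha, hb] at h1
        have := congrFun (congrFun hsym i) j
        rw [transpose_apply, h1] at this
        exact this.symm
    set P := Q * Qᵀ with hP
    have hPT : Pᵀ = P := by simp [hP, Matrix.transpose_mul]
    have hPP : P * P = P := by
      calc P * P = Q * (Qᵀ * Q) * Qᵀ := by simp only [hP, Matrix.mul_assoc]
        _ = P := by simp [hQ1, hP]
    have hPN : P * N * P + P * Nᵀ * P = 0 := by
      calc _ = Q * (Qᵀ * (N + Nᵀ) * Q) * Qᵀ := by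
            simp only [hP, Matrix.mul_add, Matrix.add_mul, Matrix.mul_assoc]
        _ = 0 := by simp [h0]
    refine ⟨N * P - P * Nᵀ + P * Nᵀ * P, ?_, ?_⟩
    · change _ = _
      have : P * Nᵀ * P = - (P * N * P) := by rw [eq_neg_iff_add_eq_zero, add_comm]; exact hPN
      rw [this]
      have e : (N * P - P * Nᵀ + -(P * N * P))ᵀ = P * Nᵀ - N * P - P * Nᵀ * P := by
        simp [Matrix.transpose_mul, hPT, Matrix.mul_assoc, sub_eq_add_neg]
      rw [e, this]; abel
    · intro u hu
      have hu' : P *ᵥ u = u := by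
        have := hQ2 (WithLp.toLp 2 u) ⟨u, hu, rfl⟩
        simpa [hP, Matrix.mulVec_mulVec] using this
      conv_lhs => rw [← hu']
      rw [Matrix.mulVec_mulVec]
      have : (N * P - P * Nᵀ + P * Nᵀ * P) * P = N * P := by
        simp only [Matrix.add_mul, Matrix.sub_mul, Matrix.mul_assoc, hPP]; abel
      rw [this, ← Matrix.mulVec_mulVec, hu']
  · have h1 := LinearMap.finrank_range_add_finrank_ker g
    have h2 := Submodule.finrank_le (LinearMap.range g)
    rw [Module.finrank_fintype_fun_eq_card, Sym2.card, Fintype.card_fin] at h2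
    rw [Module.finrank_matrix] at h1
    simp at h1
    omega

lemma cobound_mat {E : Type*} [DecidableEq E] {d n : ℕ} (tail head : E → Fin n)
    (c : E → Fin d → ℤ) (F : Finset E) (M : Matrix (Fin d) (Fin d) ℝ)
    (hM : ∀ y ∈ cycleImage d n tail head c F, M *ᵥ y = 0) :
    ∃ p : Fin n → Fin d → ℝ, ∀ e ∈ F,
      p (head e) - p (tail e) = M *ᵥ (fun r => (c e r : ℝ)) := by
  have : ∀ r : Fin d, ∃ p : Fin n → ℝ, ∀ e ∈ F,
      p (head e) - p (tail e) = (M *ᵥ (fun r => (c e r : ℝ))) r := by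
    intro r
    apply cobound
    intro x hx1 hx2
    have h := congrFun (hM _ ⟨x, hx1, hx2, rfl⟩) r
    refine Eq.trans ?_ h
    simp only [mulVec, dotProduct, Finset.mul_sum]
    rw [Finset.sum_comm]
    exact Finset.sum_congr rfl fun i _ => Finset.sum_congr rfl fun j _ => by ring
  choose p hp using this
  refine ⟨fun v r => p r v, fun e he => ?_⟩
  ext r
  exact hp r e he

/-- vertex classes -/
abbrev CC {V E : Type*} [DecidableEq V] (tail head : E → V) (F : Finset E) : Type _ :=
  Quot fun u v : {x : V // x ∈ incVerts tail head F} => adjRel tail head F u.1 v.1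

lemma tail_mem {V E : Type*} [DecidableEq V] (tail head : E → V) (F : Finset E) {e : E}
    (he : e ∈ F) : tail e ∈ incVerts tail head F :=
  Finset.mem_union_left _ (Finset.mem_image_of_mem _ he)

lemma head_mem {V E : Type*} [DecidableEq V] (tail head : E → V) (F : Finset E) {e : E}
    (he : e ∈ F) : head e ∈ incVerts tail head F :=
  Finset.mem_union_right _ (Finset.mem_image_of_mem _ he)

/-- class of a vertex -/
def cls {V E : Type*} [DecidableEq V] (tail head : E → V) (F : Finset E)
    (v : {x : V // x ∈ incVerts tail head F}) : CC tail head F := Quot.mk _ v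

lemma cls_edge {V E : Type*} [DecidableEq V] (tail head : E → V) (F : Finset E) {e : E}
    (he : e ∈ F) : cls tail head F ⟨tail e, tail_mem tail head F he⟩ =
      cls tail head F ⟨head e, head_mem tail head F he⟩ :=
  Quot.sound ⟨e, he, Or.inl ⟨rfl, rfl⟩⟩

lemma cls_iff {V E : Type*} [DecidableEq V] (tail head : E → V) (F : Finset E)
    (u v : {x : V // x ∈ incVerts tail head F}) :
    Relation.EqvGen (adjRel tail head F) u.1 v.1 ↔
      cls tail head F u = cls tail head F v := by
  constructor
  · intro h
    have key : ∀ a b : V, Relation.EqvGen (adjRel tail head F) a b → a = b ∨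
        ∃ (ha : a ∈ incVerts tail head F) (hb : b ∈ incVerts tail head F),
          cls tail head F ⟨a, ha⟩ = cls tail head F ⟨b, hb⟩ := by
      intro a b hab
      induction hab with
      | rel a b hab =>
        right
        obtain ⟨e, he, ⟨rfl, rfl⟩ | ⟨rfl, rfl⟩⟩ := hab
        · exact ⟨tail_mem _ _ _ he, head_mem _ _ _ he, cls_edge tail head F he⟩
        · exact ⟨head_mem _ _ _ he, tail_mem _ _ _ he, (cls_edge tail head F he).symm⟩
      | refl a => exact Or.inl rfl
      | symm a b _ ih =>
        rcases ih with rfl | ⟨ha, hb, h⟩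
        · exact Or.inl rfl
        · exact Or.inr ⟨hb, ha, h.symm⟩
      | trans a b c _ _ ih1 ih2 =>
        rcases ih1 with rfl | ⟨ha, hb, h⟩
        · exact ih2
        · rcases ih2 with rfl | ⟨hb', hc, h'⟩
          · exact Or.inr ⟨ha, hb, h⟩
          · exact Or.inr ⟨ha, hc, h.trans h'⟩
    rcases key _ _ h with h | ⟨_, _, h⟩
    · rw [Subtype.ext h]
    · exact h
  · intro h
    have h' := Quot.eqvGen_exact h
    clear h
    induction h' with
    | rel a b hab => exact Relation.EqvGen.rel _ _ hab
    | refl a => exact Relation.EqvGen.refl _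
    | symm a b _ ih => exact Relation.EqvGen.symm _ _ ih
    | trans a b c _ _ ih1 ih2 => exact Relation.EqvGen.trans _ _ _ ih1 ih2

open scoped Classical in
/-- edges of a class -/
noncomputable def compE {V E : Type*} [DecidableEq V] (tail head : E → V) (F : Finset E)
    (q : CC tail head F) : Finset E :=
  F.filter fun e => ∃ h : e ∈ F, cls tail head F ⟨tail e, tail_mem tail head F h⟩ = q

open scoped Classical in
lemma mem_compE {V E : Type*} [DecidableEq V] (tail head : E → V) (F : Finset E)
    (q : CC tail head F) (e : E) : e ∈ compE tail head F q ↔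
      ∃ h : e ∈ F, cls tail head F ⟨tail e, tail_mem tail head F h⟩ = q := by
  unfold compE
  rw [Finset.mem_filter]
  exact ⟨fun h => h.2, fun h => ⟨h.1, h⟩⟩

lemma cls_surj {V E : Type*} [DecidableEq V] (tail head : E → V) (F : Finset E)
    (q : CC tail head F) : ∃ e, ∃ he : e ∈ F,
      cls tail head F ⟨tail e, tail_mem tail head F he⟩ = q := by
  induction q using Quot.ind with
  | mk v =>
    obtain ⟨v, hv⟩ := v
    rcases Finset.mem_union.1 hv with h | h
    · obtain ⟨e, he, rfl⟩ := Finset.mem_image.1 h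
      exact ⟨e, he, rfl⟩
    · obtain ⟨e, he, rfl⟩ := Finset.mem_image.1 h
      exact ⟨e, he, cls_edge tail head F he⟩

open scoped Classical in
lemma sum_components {V E : Type*} [DecidableEq V] [DecidableEq E] (tail head : E → V)
    (F : Finset E) [Fintype (CC tail head F)] (f : Finset E → ℕ) :
    ∑ F' ∈ components tail head F, f F' = ∑ q : CC tail head F, f (compE tail head F q) := by
  have hc : components tail head F = Finset.univ.image (compE tail head F) := by
    have h1 : ∀ e (he : e ∈ F),
        (F.filter fun e' => Relation.EqvGen (adjRel tail head F) (tail e) (tail e')) =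
        compE tail head F (cls tail head F ⟨tail e, tail_mem tail head F he⟩) := by
      intro e he
      ext e'
      rw [mem_compE, Finset.mem_filter]
      constructor
      · rintro ⟨he', h⟩
        exact ⟨he', ((cls_iff tail head F ⟨tail e, tail_mem tail head F he⟩
          ⟨tail e', tail_mem tail head F he'⟩).1 h).symm⟩
      · rintro ⟨he', h⟩
        exact ⟨he', (cls_iff tail head F ⟨tail e, tail_mem tail head F he⟩
          ⟨tail e', tail_mem tail head F he'⟩).2 h.symm⟩
    ext S
    simp only [components, Finset.mem_image, Finset.mem_univ, true_and]
    constructor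
    · rintro ⟨e, he, rfl⟩
      exact ⟨_, (h1 e he).symm⟩
    · rintro ⟨q, rfl⟩
      obtain ⟨e, he, rfl⟩ := cls_surj tail head F q
      exact ⟨e, he, h1 e he⟩
  rw [hc, Finset.sum_image]
  intro q _ q' _ h
  obtain ⟨e, he, rfl⟩ := cls_surj tail head F q
  have : e ∈ compE tail head F q' := by
    rw [← h]
    exact (mem_compE tail head F _ e).2 ⟨he, rfl⟩
  obtain ⟨_, h⟩ := (mem_compE tail head F _ e).1 this
  exact h

lemma skew_dot {d : ℕ} {A : Matrix (Fin d) (Fin d) ℝ} (hA : A ∈ Sk d) (x : Fin d → ℝ) :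
    (A *ᵥ x) ⬝ᵥ x = 0 := by
  have hA : Aᵀ = -A := hA
  have h : (A *ᵥ x) ⬝ᵥ x = - ((A *ᵥ x) ⬝ᵥ x) := by
    conv_lhs => rw [dotProduct_comm, dotProduct_mulVec, ← mulVec_transpose, hA, neg_mulVec,
      neg_dotProduct]
  linarith

section maps
variable {d n : ℕ} {E : Type*} (tail head : E → Fin n)
    (Λ : Matrix (Fin d) (Fin d) ℝ) (c : E → Fin d → ℤ) (qm qp : E → Fin d → ℝ) (F : Finset E)

/-- translation part -/
noncomputable def LP : ((incVerts tail head F) → Fin d → ℝ) →ₗ[ℝ] (F → ℝ) where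
  toFun p e := (p ⟨head e.1, head_mem tail head F e.2⟩ - p ⟨tail e.1, tail_mem tail head F e.2⟩)
    ⬝ᵥ edgeVec d Λ c qm qp e.1
  map_add' a b := by
    ext e
    simp only [Pi.add_apply, sub_dotProduct, add_dotProduct]; ring
  map_smul' a b := by
    ext e
    simp only [Pi.smul_apply, sub_dotProduct, smul_dotProduct, smul_eq_mul, RingHom.id_apply]
    ring

/-- rotation part -/
noncomputable def LA : ((incVerts tail head F) → Sk d) →ₗ[ℝ] (F → ℝ) where
  toFun A e := ((A ⟨head e.1, head_mem tail head F e.2⟩).1 *ᵥ qp e.1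
      - (A ⟨tail e.1, tail_mem tail head F e.2⟩).1 *ᵥ qm e.1)
    ⬝ᵥ edgeVec d Λ c qm qp e.1
  map_add' a b := by
    ext e
    simp only [Pi.add_apply, sub_dotProduct, Submodule.coe_add, add_mulVec, add_dotProduct]; ring
  map_smul' a b := by
    ext e
    simp only [Pi.smul_apply, sub_dotProduct, smul_dotProduct, smul_eq_mul, RingHom.id_apply,
      Submodule.coe_smul, smul_mulVec]
    ring

/-- lattice part -/
noncomputable def LM : Matrix (Fin d) (Fin d) ℝ →ₗ[ℝ] (F → ℝ) where
  toFun M e := (M *ᵥ (fun r => (c e.1 r : ℝ))) ⬝ᵥ edgeVec d Λ c qm qp e.1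
  map_add' a b := by
    ext e
    simp only [Pi.add_apply, add_mulVec, add_dotProduct]
  map_smul' a b := by
    ext e
    simp only [Pi.smul_apply, smul_dotProduct, smul_eq_mul, RingHom.id_apply, smul_mulVec]

lemma rank_le_sup :
    rigidityRank d n tail head Λ c qm qp F ≤ Module.finrank ℝ
      ((LinearMap.range (LP tail head Λ c qm qp F) ⊔ LinearMap.range (LA tail head Λ c qm qp F))
        ⊔ LinearMap.range (LM Λ c qm qp F) : Submodule ℝ (F → ℝ)) := by
  apply Submodule.finrank_mono
  rw [Submodule.span_le]
  rintro _ ⟨x, rfl⟩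
  have hsk : ∀ B : Matrix (Fin d) (Fin d) ℝ, B - Bᵀ ∈ Sk d := by
    intro B
    change _ = _
    simp
  have e : (fun e : F => rowVal d n tail head Λ c qm qp x e.1) =
      (LP tail head Λ c qm qp F (fun v => x.1 v.1)
        + LA tail head Λ c qm qp F (fun v => ⟨_, hsk (x.2.1 v.1)⟩))
        + LM Λ c qm qp F x.2.2 := by
    ext e
    simp only [rowVal, LP, LA, LM, LinearMap.coe_mk, AddHom.coe_mk, Pi.add_apply,
      ← add_dotProduct]
    congr 1
    abel
  refine Set.mem_of_eq_of_mem e ?_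
  exact Submodule.add_mem_sup (Submodule.add_mem_sup ⟨_, rfl⟩ ⟨_, rfl⟩) ⟨_, rfl⟩

lemma stepP : Module.finrank ℝ (LinearMap.range (LP tail head Λ c qm qp F))
    + d * numComp tail head F ≤ d * (incVerts tail head F).card := by
  classical
  have : Finite (CC tail head F) := Quot.finite _
  have : Fintype (CC tail head F) := Fintype.ofFinite _
  let g : (CC tail head F → Fin d → ℝ) →ₗ[ℝ] ((incVerts tail head F) → Fin d → ℝ) :=
    LinearMap.funLeft ℝ (Fin d → ℝ) (cls tail head F)
  have hg : Function.Injective g :=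
    LinearMap.funLeft_injective_of_surjective _ _ _ (fun q => Quot.exists_rep q)
  have := rank_step (LP tail head Λ c qm qp F) ⊥ (LinearMap.range g) (by
    rintro _ ⟨y, rfl⟩
    rw [Submodule.mem_bot]
    ext e
    simp only [LP, g, LinearMap.coe_mk, AddHom.coe_mk, LinearMap.funLeft_apply,
      cls_edge tail head F e.2]
    simp)
  rw [bot_sup_eq, LinearMap.finrank_range_of_inj hg, finrank_bot] at this
  simp only [Module.finrank_pi_fintype, Module.finrank_self, Finset.sum_const, Finset.card_univ,
    smul_eq_mul, mul_one, Fintype.card_fin, Fintype.card_coe] at this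
  rw [numComp, Nat.card_eq_fintype_card]
  linarith

lemma stepA [DecidableEq E] :
    Module.finrank ℝ (LinearMap.range (LP tail head Λ c qm qp F) ⊔
      LinearMap.range (LA tail head Λ c qm qp F) : Submodule ℝ (F → ℝ))
    + ∑ F' ∈ components tail head F, (d - cycleRank d n tail head c F').choose 2 ≤
     Module.finrank ℝ (LinearMap.range (LP tail head Λ c qm qp F)) +
      d.choose 2 * (incVerts tail head F).card := by
  classical
  have : Finite (CC tail head F) := Quot.finite _
  have : Fintype (CC tail head F) := Fintype.ofFinite _
  rw [sum_components tail head F (fun F' => (d - cycleRank d n tail head c F').choose 2)]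
  have hS := fun q : CC tail head F => finrank_skU
    ((Submodule.span ℝ (cycleImage d n tail head c (compE tail head F q))).map Λ.mulVecLin)
    (Submodule.finrank_map_le _ _)
  choose S hS1 hS2 hS3 using hS
  let g : ((q : CC tail head F) → S q) →ₗ[ℝ] ((incVerts tail head F) → Sk d) :=
    LinearMap.pi fun v => (Submodule.inclusion (hS1 (cls tail head F v))).comp
      (LinearMap.proj (cls tail head F v))
  have hg : Function.Injective g := by
    intro a b hab
    ext q : 1
    obtain ⟨v, rfl⟩ := Quot.exists_rep q
    have := congrFun hab v
    exact Submodule.inclusion_injective (hS1 (cls tail head F v)) this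
  have := rank_step (LA tail head Λ c qm qp F) (LinearMap.range (LP tail head Λ c qm qp F))
    (LinearMap.range g) (by
    rintro _ ⟨A, rfl⟩
    have hp : ∀ q : CC tail head F, ∃ p : Fin n → Fin d → ℝ, ∀ e ∈ compE tail head F q,
      p (head e) - p (tail e) = ((A q).1 * Λ) *ᵥ (fun r => (c e r : ℝ)) := by
      intro q
      apply cobound_mat
      intro y hy
      rw [← mulVec_mulVec]
      exact hS2 q _ (A q).2 _ ⟨y, Submodule.subset_span hy, rfl⟩
    choose p hp using hp
    refine ⟨fun v => - p (cls tail head F v) v.1, ?_⟩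
    ext e
    set q := cls tail head F ⟨tail e.1, tail_mem tail head F e.2⟩ with hq
    have hq' : cls tail head F ⟨head e.1, head_mem tail head F e.2⟩ = q :=
      (cls_edge tail head F e.2).symm
    have h1 := hp q e.1 ((mem_compE tail head F _ e.1).2 ⟨e.2, rfl⟩)
    have h2 : (g A ⟨head e.1, head_mem tail head F e.2⟩).1 = (A q).1 := by
      rw [← hq']; rfl
    have h3 : (g A ⟨tail e.1, tail_mem tail head F e.2⟩).1 = (A q).1 := rfl
    simp only [LP, LA, LinearMap.coe_mk, AddHom.coe_mk, h2, h3, hq', ← hq]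
    have h4 := skew_dot (hS1 q (A q).2) (edgeVec d Λ c qm qp e.1)
    have h5 : (A q).1 *ᵥ edgeVec d Λ c qm qp e.1 = (p q (head e.1) - p q (tail e.1))
      + ((A q).1 *ᵥ qp e.1 - (A q).1 *ᵥ qm e.1) := by
      rw [h1, edgeVec, mulVec_sub, mulVec_add, mulVec_mulVec]; abel
    rw [h5, add_dotProduct] at h4
    have h6 : - p q (head e.1) - - p q (tail e.1) = -(p q (head e.1) - p q (tail e.1)) := by abel
    rw [h6, neg_dotProduct]
    linarith)
  rw [LinearMap.finrank_range_of_inj hg] at this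
  simp only [Module.finrank_pi_fintype, finrank_Sk, Finset.sum_const, Finset.card_univ,
    smul_eq_mul, Fintype.card_coe] at this
  have h := Finset.sum_le_sum (fun q (_ : q ∈ Finset.univ) => hS3 q)
  simp only [cycleRank]
  rw [mul_comm (d.choose 2)]
  linarith

lemma stepM [DecidableEq E] (hΛ : IsUnit Λ) :
    Module.finrank ℝ
      ((LinearMap.range (LP tail head Λ c qm qp F) ⊔ LinearMap.range (LA tail head Λ c qm qp F))
        ⊔ LinearMap.range (LM Λ c qm qp F) : Submodule ℝ (F → ℝ)) ≤
    Module.finrank ℝ (LinearMap.range (LP tail head Λ c qm qp F) ⊔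
      LinearMap.range (LA tail head Λ c qm qp F) : Submodule ℝ (F → ℝ)) +
      (cycleRank d n tail head c F + 1).choose 2 := by
  obtain ⟨S, hS1, hS2⟩ := finrank_symU
    ((Submodule.span ℝ (cycleImage d n tail head c F)).map Λ.mulVecLin)
  have hU := Submodule.finrank_map_le Λ.mulVecLin
    (Submodule.span ℝ (cycleImage d n tail head c F))
  have hU2 := Nat.choose_le_choose 2 (Nat.add_le_add_right hU 1)
  let m : Matrix (Fin d) (Fin d) ℝ →ₗ[ℝ] Matrix (Fin d) (Fin d) ℝ := LinearMap.mulRight ℝ Λ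
  have hm : Function.Injective m := fun a b h => hΛ.mul_right_cancel h
  have := rank_step (LM Λ c qm qp F) (LinearMap.range (LP tail head Λ c qm qp F) ⊔
      LinearMap.range (LA tail head Λ c qm qp F)) (S.map m) (by
    rintro _ ⟨N, hN, rfl⟩
    obtain ⟨A, hA, hAN⟩ := hS1 N hN
    obtain ⟨p, hp⟩ := cobound_mat tail head c F ((N - A) * Λ) (by
      intro y hy
      rw [← mulVec_mulVec, sub_mulVec, sub_eq_zero]
      exact (hAN _ ⟨y, Submodule.subset_span hy, rfl⟩).symm)
    have e : LM Λ c qm qp F (m N) = LP tail head Λ c qm qp F (fun v => p v.1)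
        + LA tail head Λ c qm qp F (fun _ => -⟨A, hA⟩) := by
      ext e
      have h1 := hp e.1 e.2
      simp only [LM, LP, LA, LinearMap.coe_mk, AddHom.coe_mk, Pi.add_apply, h1,
        Submodule.coe_neg, neg_mulVec]
      have h4 := skew_dot hA (edgeVec d Λ c qm qp e.1)
      have h5 : A *ᵥ edgeVec d Λ c qm qp e.1 = (A * Λ) *ᵥ (fun r => (c e.1 r : ℝ))
        + A *ᵥ qp e.1 - A *ᵥ qm e.1 := by
        rw [edgeVec, mulVec_sub, mulVec_add, mulVec_mulVec]
      rw [h5] at h4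
      change ((N * Λ) *ᵥ _) ⬝ᵥ _ = _
      rw [Matrix.sub_mul, sub_mulVec]
      simp only [add_dotProduct, sub_dotProduct, neg_dotProduct] at h4 ⊢
      linarith
    rw [e]
    exact Submodule.add_mem_sup ⟨_, rfl⟩ ⟨_, rfl⟩)
  rw [← LinearEquiv.finrank_eq (Submodule.equivMapOfInjective m hm _),
    Module.finrank_matrix] at this
  simp only [Fintype.card_fin, Module.finrank_self, mul_one] at this
  simp only [cycleRank]
  omega

end maps

/-- refined necessary sparsity condition in terms of the periodic graph
`(G,Γ)`.  For any presentation and any nonempty `F ⊆ E`, the rank of the rows of the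
rigidity matrix indexed by `F` is at most
`d(n_F − ω_F) + C(d,2)·n_F − Σ_{F'} C(d − d_{F'}, 2) + C(d_F + 1, 2)`, the sum being over
the connected components `F'` of `(V_F, F)`. -/
theorem stmt_15 {d n : ℕ} (hd : 1 ≤ d) {E : Type*} [Fintype E] [DecidableEq E]
    (tail head : E → Fin n)
    (Λ : Matrix (Fin d) (Fin d) ℝ) (c : E → Fin d → ℤ) (qm qp : E → Fin d → ℝ)
    (hΛ : IsUnit Λ) (hh : ∀ e, edgeVec d Λ c qm qp e ≠ 0) :
    ∀ F : Finset E, F.Nonempty →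
      (rigidityRank d n tail head Λ c qm qp F : ℤ) ≤
        (d : ℤ) * ((incVerts tail head F).card - numComp tail head F)
          + (d.choose 2 : ℤ) * (incVerts tail head F).card
          - (∑ F' ∈ components tail head F,
              (((d - cycleRank d n tail head c F').choose 2 : ℕ) : ℤ))
          + (((cycleRank d n tail head c F + 1).choose 2 : ℕ) : ℤ) := by
  intro F _
  have h0 := rank_le_sup tail head Λ c qm qp F
  have h1 := stepP tail head Λ c qm qp F
  have h2 := stepA tail head Λ c qm qp F
  have h3 := stepM tail head Λ c qm qp F hΛ
  zify at h0 h1 h2 h3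
  rw [mul_sub]
  linarith
end

section
/- Let d ≥ 1 and 0 ≤ k ≤ d, and let G be a multigraph on vertex set V = {1,…,n} with edge set E in which every vertex carries the same weight k_v = k, so that k_v′ = dk − binom(k+1,2) for all v. Assume |E| = (d(k+1) − binom(k+1,2))·n + d² − binom(d+1,2). Then there exists a mixed presentation of G whose mixed rigidity matrix has rank |E| if and only if E contains two disjoint subsets F₁ and F₂ such that F₁ is (d,d)-tight (|F₁| = dn − d) and F₂ is (dk − binom(k+1,2), 0)-tight (|F₂| = (dk − binom(k+1,2))·n). (Characterization of minimally rigid d-periodic frameworks of k-dimensional plates connected by bars.) -/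
open Matrix

/-- The restricted skew-symmetric rotation unknown of a vertex of weight `k`: as `B`
ranges over all matrices, `restrictedSkew d k B` ranges over all skew-symmetric `d × d`
matrices whose `(r,s)` entry vanishes whenever both `r` and `s` exceed `k` (in 1-based
indexing), i.e. over a space of dimension `d·k − C(k+1,2)`. -/
noncomputable def restrictedSkew (d k : ℕ) (B : Matrix (Fin d) (Fin d) ℝ) :
    Matrix (Fin d) (Fin d) ℝ :=
  Matrix.of fun r s => if k ≤ (r : ℕ) ∧ k ≤ (s : ℕ) then 0 else B r s - B s r

/-- The value of the row of the mixed rigidity matrix indexed by the edge `e`, evaluated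
at the vector of unknowns `x`:
`⟨Λ̇ c(e) + A_{head e} q⁺(e) − A_{tail e} q⁻(e) + ṗ_{head e} − ṗ_{tail e}, h(e)⟩`. -/
noncomputable def mixedRowVal {E : Type*} (d n : ℕ) (k : Fin n → ℕ)
    (tail head : E → Fin n)
    (Λ : Matrix (Fin d) (Fin d) ℝ) (c : E → Fin d → ℤ) (qm qp : E → Fin d → ℝ)
    (x : RigDom d n) (e : E) : ℝ :=
  (x.2.2.mulVec (fun r => (c e r : ℝ))
      + (restrictedSkew d (k (head e)) (x.2.1 (head e))).mulVec (qp e)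
      - (restrictedSkew d (k (tail e)) (x.2.1 (tail e))).mulVec (qm e)
      + x.1 (head e) - x.1 (tail e))
    ⬝ᵥ edgeVec d Λ c qm qp e

/-- The rank of the submatrix of the mixed rigidity matrix formed by the rows indexed
by `F`. -/
noncomputable def mixedRigidityRank {E : Type*} (d n : ℕ) (k : Fin n → ℕ)
    (tail head : E → Fin n)
    (Λ : Matrix (Fin d) (Fin d) ℝ) (c : E → Fin d → ℤ) (qm qp : E → Fin d → ℝ)
    (F : Finset E) : ℕ :=
  Module.finrank ℝ (Submodule.span ℝ
    (Set.range fun x : RigDom d n =>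
      fun e : F => mixedRowVal d n k tail head Λ c qm qp x e.1))

/-- A mixed presentation: the last `d − k_v` coordinates of the attachment of each bar end
on a plate of weight `k_v` vanish. -/
def IsMixedAttachment {E : Type*} (d n : ℕ) (k : Fin n → ℕ) (tail head : E → Fin n)
    (qm qp : E → Fin d → ℝ) : Prop :=
  ∀ e, ∀ r : Fin d,
    (k (tail e) ≤ (r : ℕ) → qm e r = 0) ∧ (k (head e) ≤ (r : ℕ) → qp e r = 0)

/-- An edge set `F` is `(a,b)`-sparse if every nonempty `U ⊆ V` spans at most `a|U| + b`
edges of `F`. -/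
def Sparse {V E : Type*} [DecidableEq V] [DecidableEq E] (tail head : E → V)
    (a : ℕ) (b : ℤ) (F : Finset E) : Prop :=
  ∀ U : Finset V, U.Nonempty →
    ((F.filter fun e => tail e ∈ U ∧ head e ∈ U).card : ℤ) ≤ a * U.card + b

/-- An edge set `F` is `(a,b)`-tight if it is `(a,b)`-sparse and `|F| = a|V| + b`. -/
def Tight {V E : Type*} [Fintype V] [DecidableEq V] [DecidableEq E] (tail head : E → V)
    (a : ℕ) (b : ℤ) (F : Finset E) : Prop :=
  Sparse tail head a b F ∧ (F.card : ℤ) = a * Fintype.card V + b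

section GenericLemmas
open Module

variable {ι V : Type*} [Fintype ι] [DecidableEq ι] [AddCommGroup V] [Module ℝ V]

theorem aux_exists_coord {v : ι → V} (hv : LinearIndependent ℝ v) :
    ∃ f : V →ₗ[ℝ] (ι → ℝ), Matrix.detRowAlternating (fun i => f (v i)) ≠ 0 := by
  obtain ⟨g, hg⟩ := LinearMap.exists_extend
    ((Basis.span hv).constr ℝ (fun i => (Pi.single i (1:ℝ) : ι → ℝ)))
  refine ⟨g, ?_⟩
  have h : ∀ i, g (v i) = Pi.single i (1:ℝ) := by
    intro i
    have h1 := (Basis.span hv).constr_basis ℝ (fun i => (Pi.single i (1:ℝ) : ι → ℝ)) i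
    rw [← hg] at h1
    simpa [Basis.span_apply] using h1
  have h2 : (fun i => g (v i)) = (1 : Matrix ι ι ℝ) := by
    funext i j
    rw [h i, Matrix.one_apply, Pi.single_apply]
    simp [eq_comm]
  rw [h2]
  change Matrix.det (1 : Matrix ι ι ℝ) ≠ 0
  simp

theorem aux_indep_of_det {v : ι → V} (f : V →ₗ[ℝ] (ι → ℝ))
    (h : Matrix.detRowAlternating (fun i => f (v i)) ≠ 0) : LinearIndependent ℝ v := by
  have h1 : LinearIndependent ℝ (fun i => f (v i)) :=
    Matrix.linearIndependent_rows_of_det_ne_zero (A := Matrix.of (fun i => f (v i))) h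
  exact LinearIndependent.of_comp f h1

theorem aux_select_sum {κ : Type*} [Fintype κ] (g : ι → κ → V)
    (h : LinearIndependent ℝ (fun i => ∑ j, g i j)) :
    ∃ r : ι → κ, LinearIndependent ℝ (fun i => g i (r i)) := by
  obtain ⟨f, hf⟩ := aux_exists_coord h
  have h1 : Matrix.detRowAlternating (fun i => f (∑ j, g i j))
      = ∑ r : ι → κ, (Matrix.detRowAlternating : (ι → ℝ) [⋀^ι]→ₗ[ℝ] ℝ)
          (fun i => f (g i (r i))) := by
    simp only [map_sum]
    exact MultilinearMap.map_sum
      (Matrix.detRowAlternating : (ι → ℝ) [⋀^ι]→ₗ[ℝ] ℝ).toMultilinearMap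
      (fun i j => f (g i j))
  rw [h1] at hf
  obtain ⟨r, _, hr⟩ := Finset.exists_ne_zero_of_sum_ne_zero hf
  exact ⟨r, aux_indep_of_det f hr⟩

theorem aux_select_span (X : ι → Set V) (w : ι → V)
    (hw : ∀ i, w i ∈ Submodule.span ℝ (X i)) (h : LinearIndependent ℝ w) :
    ∃ x : ι → V, (∀ i, x i ∈ X i) ∧ LinearIndependent ℝ x := by
  obtain ⟨f, hf⟩ := aux_exists_coord h
  have key : ∀ s : Finset ι, ∃ y : ι → V, (∀ i ∈ s, y i ∈ X i) ∧ (∀ i ∉ s, y i = w i) ∧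
      (Matrix.detRowAlternating : (ι → ℝ) [⋀^ι]→ₗ[ℝ] ℝ) (fun i => f (y i)) ≠ 0 := by
    intro s
    induction s using Finset.induction_on with
    | empty => exact ⟨w, by simp, by simp, hf⟩
    | insert a s ha ih =>
      obtain ⟨y, hy1, hy2, hy3⟩ := ih
      let φ : V →ₗ[ℝ] ℝ :=
        ((Matrix.detRowAlternating : (ι → ℝ) [⋀^ι]→ₗ[ℝ] ℝ).toMultilinearMap.toLinearMap
          (fun i => f (y i)) a) ∘ₗ f
      have hφ : ∀ t, φ t = (Matrix.detRowAlternating : (ι → ℝ) [⋀^ι]→ₗ[ℝ] ℝ)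
          (fun i => f (Function.update y a t i)) := by
        intro t
        have : (fun i => f (Function.update y a t i))
            = Function.update (fun i => f (y i)) a (f t) := by
          funext i
          by_cases hi : i = a
          · subst hi; simp
          · simp [hi]
        rw [this]
        rfl
      have hne : ∃ t ∈ X a, φ t ≠ 0 := by
        by_contra hcon
        push Not at hcon
        have hle : Submodule.span ℝ (X a) ≤ LinearMap.ker φ :=
          Submodule.span_le.2 (fun t ht => by simpa using hcon t ht)
        have h0 : φ (w a) = 0 := by simpa using hle (hw a)
        rw [hφ, ← hy2 a ha, Function.update_eq_self] at h0
        exact hy3 h0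
      obtain ⟨t, ht, ht0⟩ := hne
      refine ⟨Function.update y a t, ?_, ?_, ?_⟩
      · intro i hi
        by_cases hia : i = a
        · subst hia; simpa using ht
        · simp only [Function.update_of_ne hia]
          exact hy1 i ((Finset.mem_insert.1 hi).resolve_left hia)
      · intro i hi
        simp only [Finset.mem_insert, not_or] at hi
        simp only [Function.update_of_ne hi.1]
        exact hy2 i hi.2
      · rw [← hφ]; exact ht0
  obtain ⟨y, hy1, _, hy3⟩ := key Finset.univ
  exact ⟨y, fun i => hy1 i (Finset.mem_univ i), aux_indep_of_det f hy3⟩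

theorem aux_indep_iff_surj (f : ι → Module.Dual ℝ V) :
    LinearIndependent ℝ f ↔ LinearMap.range (LinearMap.pi f) = ⊤ := by
  constructor
  · intro h
    by_contra hne
    obtain ⟨φ, hφ, hle⟩ := Submodule.exists_le_ker_of_lt_top _ (lt_top_iff_ne_top.2 hne)
    apply hφ
    have h1 : ∑ i, φ (Pi.single i 1) • f i = 0 := by
      ext x
      have hx : φ (LinearMap.pi f x) = 0 := hle ⟨x, rfl⟩
      rw [LinearMap.pi_apply_eq_sum_univ] at hx
      have hs : ∀ i : ι, (fun j => if i = j then (1:ℝ) else 0) = Pi.single i (1:ℝ) := by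
        intro i
        funext j
        simp [Pi.single_apply, eq_comm]
      simpa [mul_comm, hs] using hx
    have h2 := Fintype.linearIndependent_iff.1 h _ h1
    ext i
    simpa using h2 i
  · intro h
    rw [LinearMap.range_eq_top] at h
    rw [Fintype.linearIndependent_iff]
    intro g hg i
    obtain ⟨x, hx⟩ := h (Pi.single i 1)
    have h1 := LinearMap.congr_fun hg x
    have h2 : ∀ j, f j x = (Pi.single i (1:ℝ) : ι → ℝ) j := fun j => congrFun hx j
    simpa [h2, Pi.single_apply] using h1

theorem aux_card_le {v : ι → V} (hv : LinearIndependent ℝ v) (s : Finset ι)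
    {κ : Type*} (t : Finset κ) (b : κ → V)
    (h : ∀ i ∈ s, v i ∈ Submodule.span ℝ (b '' t)) : s.card ≤ t.card := by
  classical
  have h1 : LinearIndependent ℝ (fun i : s => v i) := hv.comp _ Subtype.val_injective
  have h2 := linearIndependent_iff_card_le_finrank_span.1 h1
  have h3 : Submodule.span ℝ (Set.range (fun i : s => v i)) ≤
      Submodule.span ℝ ((t.image b : Finset V) : Set V) := by
    rw [Submodule.span_le]
    rintro _ ⟨i, rfl⟩
    rw [Finset.coe_image]
    exact h i.1 i.2
  have h4 := Submodule.finrank_mono h3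
  have h5 := finrank_span_finset_le_card (R := ℝ) (t.image b)
  have h6 : (t.image b).card ≤ t.card := Finset.card_image_le
  simp only [Fintype.card_coe] at h2
  exact h2.trans (h4.trans (h5.trans h6))

/-- Rado's theorem for finite sets of vectors. -/
theorem aux_rado [FiniteDimensional ℝ V] [DecidableEq V] (N : ℕ) : ∀ (W : ι → Finset V),
    (∑ i, (W i).card = N) →
    (∀ S : Finset ι, S.card ≤ finrank ℝ (Submodule.span ℝ ((S.biUnion W : Finset V) : Set V))) →
    ∃ w : ι → V, (∀ i, w i ∈ W i) ∧ LinearIndependent ℝ w := by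
  induction N using Nat.strong_induction_on with
  | _ N ih =>
  intro W hN hW
  by_cases hbig : ∃ i, 1 < (W i).card
  · obtain ⟨i, hi⟩ := hbig
    obtain ⟨a, ha, b, hb, hab⟩ := Finset.one_lt_card.1 hi
    have red : ∀ c ∈ W i,
        (∃ w : ι → V, (∀ i, w i ∈ W i) ∧ LinearIndependent ℝ w) ∨
        ∃ S : Finset ι, i ∈ S ∧ finrank ℝ (Submodule.span ℝ
          ((S.biUnion (Function.update W i ((W i).erase c)) : Finset V) : Set V)) < S.card := by
      intro c hc
      by_cases hall : ∀ S : Finset ι, S.card ≤ finrank ℝ (Submodule.span ℝ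
          ((S.biUnion (Function.update W i ((W i).erase c)) : Finset V) : Set V))
      · left
        have hlt : ∑ j, (Function.update W i ((W i).erase c) j).card < N := by
          rw [← hN]
          apply Finset.sum_lt_sum
          · intro j _
            by_cases hj : j = i
            · subst hj; simpa using Finset.card_le_card (Finset.erase_subset _ _)
            · simp [hj]
          · exact ⟨i, Finset.mem_univ _, by simpa using Finset.card_erase_lt_of_mem hc⟩
        obtain ⟨w, hw, hli⟩ := ih _ hlt _ rfl hall
        refine ⟨w, fun j => ?_, hli⟩
        have := hw j
        by_cases hj : j = i
        · subst hj
          simp only [Function.update_self] at this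
          exact Finset.mem_of_mem_erase this
        · simpa [hj] using this
      · right
        push Not at hall
        obtain ⟨S, hS⟩ := hall
        refine ⟨S, ?_, hS⟩
        by_contra hiS
        have : S.biUnion (Function.update W i ((W i).erase c)) = S.biUnion W := by
          apply Finset.biUnion_congr rfl
          intro j hj
          rw [Function.update_of_ne]
          rintro rfl
          exact hiS hj
        rw [this] at hS
        exact absurd (hW S) (not_le.2 hS)
    rcases red a ha with h | ⟨S1, hi1, hS1⟩
    · exact h
    rcases red b hb with h | ⟨S2, hi2, hS2⟩
    · exact h
    exfalso
    set P1 := Submodule.span ℝ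
      ((S1.biUnion (Function.update W i ((W i).erase a)) : Finset V) : Set V) with hP1
    set P2 := Submodule.span ℝ
      ((S2.biUnion (Function.update W i ((W i).erase b)) : Finset V) : Set V) with hP2
    have m1 : ∀ j ∈ S1, ∀ v ∈ W j, (j = i → v ≠ a) → v ∈ P1 := by
      intro j hj v hv hne
      apply Submodule.subset_span
      rw [Finset.mem_coe, Finset.mem_biUnion]
      refine ⟨j, hj, ?_⟩
      by_cases hji : j = i
      · subst hji; simp [hv, hne rfl]
      · simpa [hji] using hv
    have m2 : ∀ j ∈ S2, ∀ v ∈ W j, (j = i → v ≠ b) → v ∈ P2 := by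
      intro j hj v hv hne
      apply Submodule.subset_span
      rw [Finset.mem_coe, Finset.mem_biUnion]
      refine ⟨j, hj, ?_⟩
      by_cases hji : j = i
      · subst hji; simp [hv, hne rfl]
      · simpa [hji] using hv
    have u1 : Submodule.span ℝ (((S1 ∪ S2).biUnion W : Finset V) : Set V) ≤ P1 ⊔ P2 := by
      rw [Submodule.span_le]
      intro v hv
      rw [Finset.mem_coe, Finset.mem_biUnion] at hv
      obtain ⟨j, hj, hv⟩ := hv
      by_cases hji : j = i
      · subst hji
        by_cases hva : v = a
        · exact Submodule.mem_sup_right (m2 j hi2 v hv (fun _ => hva ▸ hab))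
        · exact Submodule.mem_sup_left (m1 j hi1 v hv (fun _ => hva))
      · rcases Finset.mem_union.1 hj with hj | hj
        · exact Submodule.mem_sup_left (m1 j hj v hv (fun h => absurd h hji))
        · exact Submodule.mem_sup_right (m2 j hj v hv (fun h => absurd h hji))
    have u2 : Submodule.span ℝ ((((S1 ∩ S2).erase i).biUnion W : Finset V) : Set V)
        ≤ P1 ⊓ P2 := by
      rw [Submodule.span_le]
      intro v hv
      rw [Finset.mem_coe, Finset.mem_biUnion] at hv
      obtain ⟨j, hj, hv⟩ := hv
      rw [Finset.mem_erase, Finset.mem_inter] at hj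
      exact ⟨m1 j hj.2.1 v hv (fun h => absurd h hj.1),
        m2 j hj.2.2 v hv (fun h => absurd h hj.1)⟩
    have e1 := (hW _).trans (Submodule.finrank_mono u1)
    have e2 := (hW _).trans (Submodule.finrank_mono u2)
    have e3 := Submodule.finrank_sup_add_finrank_inf_eq P1 P2
    have e4 := Finset.card_union_add_card_inter S1 S2
    have e5 := Finset.card_erase_add_one (Finset.mem_inter.2 ⟨hi1, hi2⟩)
    omega
  · push Not at hbig
    have hne : ∀ i, ∃ v, v ∈ W i := by
      intro i
      by_contra hcon
      have hempty : W i = ∅ := Finset.eq_empty_of_forall_notMem (fun v hv => hcon ⟨v, hv⟩)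
      have := hW {i}
      simp [hempty] at this
    choose w hw using hne
    refine ⟨w, hw, ?_⟩
    rw [linearIndependent_iff_card_le_finrank_span]
    refine (hW Finset.univ).trans (Submodule.finrank_mono (Submodule.span_mono ?_))
    intro v hv
    rw [Finset.mem_coe, Finset.mem_biUnion] at hv
    obtain ⟨i, _, hv⟩ := hv
    exact ⟨i, Finset.card_le_one.1 (hbig i) _ (hw i) _ hv⟩

end GenericLemmas

section Functionals
open Module

theorem aux_rs_add (d k : ℕ) (A B : Matrix (Fin d) (Fin d) ℝ) :
    restrictedSkew d k (A + B) = restrictedSkew d k A + restrictedSkew d k B := by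
  ext r s
  simp only [restrictedSkew, Matrix.of_apply, Matrix.add_apply]
  split_ifs <;> ring

theorem aux_rs_smul (d k : ℕ) (a : ℝ) (B : Matrix (Fin d) (Fin d) ℝ) :
    restrictedSkew d k (a • B) = a • restrictedSkew d k B := by
  ext r s
  simp only [restrictedSkew, Matrix.of_apply, Matrix.smul_apply, smul_eq_mul]
  split_ifs <;> ring

/-- Coordinates of the translation part. -/
noncomputable def pF (d n : ℕ) (v : Fin n) (r : Fin d) : Dual ℝ (RigDom d n) where
  toFun x := x.1 v r
  map_add' _ _ := rfl
  map_smul' _ _ := rfl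

/-- Coordinates of the rotation part. -/
noncomputable def aF (d n k : ℕ) (v : Fin n) (r s : Fin d) : Dual ℝ (RigDom d n) where
  toFun x := restrictedSkew d k (x.2.1 v) r s
  map_add' x y := by
    change restrictedSkew d k (x.2.1 v + y.2.1 v) r s = _
    rw [aux_rs_add]; rfl
  map_smul' a x := by
    change restrictedSkew d k (a • x.2.1 v) r s = _
    rw [aux_rs_smul]; rfl

/-- Coordinates of the lattice part. -/
noncomputable def lF (d n : ℕ) (r s : Fin d) : Dual ℝ (RigDom d n) where
  toFun x := x.2.2 r s
  map_add' _ _ := rfl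
  map_smul' _ _ := rfl

theorem pF_apply (d n : ℕ) (v : Fin n) (r : Fin d) (x : RigDom d n) :
    pF d n v r x = x.1 v r := rfl
theorem aF_apply (d n k : ℕ) (v : Fin n) (r s : Fin d) (x : RigDom d n) :
    aF d n k v r s x = restrictedSkew d k (x.2.1 v) r s := rfl
theorem lF_apply (d n : ℕ) (r s : Fin d) (x : RigDom d n) :
    lF d n r s x = x.2.2 r s := rfl

theorem aF_swap (d n k : ℕ) (v : Fin n) (r s : Fin d) : aF d n k v s r = - aF d n k v r s := by
  refine LinearMap.ext fun x => ?_
  simp only [LinearMap.neg_apply, aF_apply, restrictedSkew, Matrix.of_apply]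
  split_ifs <;> first | ring1 | (exfalso; tauto)

theorem aF_self (d n k : ℕ) (v : Fin n) (r : Fin d) : aF d n k v r r = 0 := by
  refine LinearMap.ext fun x => ?_
  simp [aF_apply, restrictedSkew]

theorem aF_big (d n k : ℕ) (v : Fin n) (r s : Fin d) (hr : k ≤ (r : ℕ)) (hs : k ≤ (s : ℕ)) :
    aF d n k v r s = 0 := by
  refine LinearMap.ext fun x => ?_
  simp [aF_apply, restrictedSkew, hr, hs]

/-- The row functional of an edge. -/
noncomputable def rowF (d n k : ℕ) (i j : Fin n) (Λ : Matrix (Fin d) (Fin d) ℝ)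
    (c : Fin d → ℤ) (qm qp : Fin d → ℝ) : Dual ℝ (RigDom d n) :=
  ∑ r, (edgeVec d Λ (fun _ : Unit => c) (fun _ => qm) (fun _ => qp) ()) r •
    ((∑ s, (c s : ℝ) • lF d n r s) + (∑ s, qp s • aF d n k j r s)
      - (∑ s, qm s • aF d n k i r s) + pF d n j r - pF d n i r)

theorem rowF_apply {E : Type*} (d n k : ℕ) (tail head : E → Fin n)
    (Λ : Matrix (Fin d) (Fin d) ℝ) (c : E → Fin d → ℤ) (qm qp : E → Fin d → ℝ)
    (x : RigDom d n) (e : E) :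
    mixedRowVal d n (fun _ => k) tail head Λ c qm qp x e
      = rowF d n k (tail e) (head e) Λ (c e) (qm e) (qp e) x := by
  simp only [mixedRowVal, rowF, edgeVec, dotProduct, Matrix.mulVec, LinearMap.sum_apply,
    LinearMap.smul_apply, LinearMap.add_apply, LinearMap.sub_apply, pF_apply, aF_apply, lF_apply,
    Pi.add_apply, Pi.sub_apply, smul_eq_mul]
  refine Finset.sum_congr rfl fun r _ => ?_
  rw [mul_comm]
  simp only [mul_comm]

theorem rank_iff {E : Type*} [Fintype E] [DecidableEq E] (d n k : ℕ) (tail head : E → Fin n)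
    (Λ : Matrix (Fin d) (Fin d) ℝ) (c : E → Fin d → ℤ) (qm qp : E → Fin d → ℝ) :
    mixedRigidityRank d n (fun _ => k) tail head Λ c qm qp Finset.univ = Fintype.card E ↔
    LinearIndependent ℝ (fun e => rowF d n k (tail e) (head e) Λ (c e) (qm e) (qp e)) := by
  have hinj : Function.Injective (fun e : (Finset.univ : Finset E) => e.1) :=
    Subtype.val_injective
  have h0 : LinearIndependent ℝ
      (fun e => rowF d n k (tail e) (head e) Λ (c e) (qm e) (qp e)) ↔
      LinearIndependent ℝ (fun e : (Finset.univ : Finset E) =>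
        rowF d n k (tail e.1) (head e.1) Λ (c e.1) (qm e.1) (qp e.1)) := by
    constructor
    · intro h; exact h.comp _ hinj
    · intro h
      exact h.comp (fun e => ⟨e, Finset.mem_univ e⟩) (fun a b hab => by simpa using hab)
  rw [h0, aux_indep_iff_surj]
  have h1 : Submodule.span ℝ (Set.range fun x : RigDom d n =>
      fun e : (Finset.univ : Finset E) =>
        mixedRowVal d n (fun _ => k) tail head Λ c qm qp x e.1)
      = LinearMap.range (LinearMap.pi (fun e : (Finset.univ : Finset E) =>
        rowF d n k (tail e.1) (head e.1) Λ (c e.1) (qm e.1) (qp e.1))) := by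
    rw [← Submodule.span_eq (LinearMap.range _), LinearMap.coe_range]
    congr 2
    funext x e
    rw [rowF_apply]
    rfl
  unfold mixedRigidityRank
  rw [h1]
  have hc : Fintype.card E = finrank ℝ (↥(Finset.univ : Finset E) → ℝ) := by
    rw [Module.finrank_pi]; simp
  rw [hc]
  constructor
  · exact Submodule.eq_top_of_finrank_eq
  · intro h; rw [h, finrank_top]

/-- Pairs indexing the independent rotation coordinates. -/
def KP (d k : ℕ) : Finset (Fin d × Fin d) :=
  Finset.univ.filter fun p => p.1 < p.2 ∧ (p.1 : ℕ) < k

theorem KP_card_add (d k : ℕ) (hk : k ≤ d) : (KP d k).card + (k + 1).choose 2 = d * k := by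
  induction k with
  | zero => simp [KP]
  | succ k ih =>
    have hlt : k < d := hk
    have h1 : KP d (k + 1) = KP d k ∪
        (Finset.Ioi (⟨k, hlt⟩ : Fin d)).image (fun s => ((⟨k, hlt⟩ : Fin d), s)) := by
      ext ⟨a, b⟩
      simp only [KP, Finset.mem_filter, Finset.mem_univ, true_and, Finset.mem_union,
        Finset.mem_image, Finset.mem_Ioi, Prod.mk.injEq, Fin.lt_def, Fin.ext_iff]
      constructor
      · rintro ⟨h1, h2⟩
        by_cases h : (a : ℕ) < k
        · exact Or.inl ⟨h1, h⟩
        · exact Or.inr ⟨b, by omega, by omega, rfl⟩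
      · rintro (⟨h1, h2⟩ | ⟨s, h1, h2, h3⟩)
        · exact ⟨h1, by omega⟩
        · omega
    have h2 : Disjoint (KP d k)
        ((Finset.Ioi (⟨k, hlt⟩ : Fin d)).image (fun s => ((⟨k, hlt⟩ : Fin d), s))) := by
      rw [Finset.disjoint_left]
      rintro ⟨a, b⟩ h3 h4
      simp only [KP, Finset.mem_filter, Finset.mem_univ, true_and,
        Finset.mem_image, Finset.mem_Ioi, Prod.mk.injEq, Fin.lt_def, Fin.ext_iff] at h3 h4
      obtain ⟨s, h5, h6, h7⟩ := h4
      omega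
    rw [h1, Finset.card_union_of_disjoint h2, Finset.card_image_of_injective _
      (fun a b h => by simpa using h), Fin.card_Ioi]
    have h3 := ih hlt.le
    have h4 : (k + 1 + 1).choose 2 = (k + 1) + (k + 1).choose 2 := by
      rw [Nat.choose_succ_succ' (k+1) 1, Nat.choose_one_right]
    rw [h4, Nat.mul_succ, ← h3]
    simp only
    omega

theorem KP_card (d k : ℕ) (hk : k ≤ d) : (KP d k).card = d * k - (k + 1).choose 2 := by
  have := KP_card_add d k hk
  omega

/-- Symmetric lattice functionals. -/
noncomputable def symF (d n : ℕ) : Sym2 (Fin d) → Dual ℝ (RigDom d n) :=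
  Sym2.lift ⟨fun r s => lF d n r s + lF d n s r, fun _ _ => add_comm _ _⟩

theorem symF_mk (d n : ℕ) (r s : Fin d) : symF d n s(r, s) = lF d n r s + lF d n s r := rfl

end Functionals

section Forward
open Module

theorem aux_rs_mulVec (d k : ℕ) (S : Matrix (Fin d) (Fin d) ℝ) (hS : Sᵀ = -S)
    (q : Fin d → ℝ) (hq : ∀ r : Fin d, k ≤ (r : ℕ) → q r = 0) :
    (restrictedSkew d k ((1/2 : ℝ) • S)).mulVec q = S.mulVec q := by
  funext r
  simp only [Matrix.mulVec, dotProduct]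
  refine Finset.sum_congr rfl fun s _ => ?_
  by_cases hs : k ≤ (s : ℕ)
  · simp [hq s hs]
  · have h1 : S s r = - S r s := by
      have := congrFun (congrFun hS r) s
      simpa using this
    simp only [restrictedSkew, Matrix.of_apply, Matrix.smul_apply, smul_eq_mul, hs, and_false,
      if_false, h1]
    ring

theorem aux_skew_dot (d : ℕ) (S : Matrix (Fin d) (Fin d) ℝ) (hS : Sᵀ = -S) (h : Fin d → ℝ) :
    (S.mulVec h) ⬝ᵥ h = 0 := by
  have h1 : (S.mulVec h) ⬝ᵥ h = (Sᵀ.mulVec h) ⬝ᵥ h := by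
    rw [Matrix.mulVec_transpose, dotProduct_comm, Matrix.dotProduct_mulVec]
  rw [hS, Matrix.neg_mulVec, neg_dotProduct] at h1
  linarith

/-- The three components of a row after the rotations have been factored out. -/
noncomputable def comp3 (d n k : ℕ) (i j : Fin n) (Λ : Matrix (Fin d) (Fin d) ℝ)
    (c : Fin d → ℤ) (qm qp : Fin d → ℝ) : Fin 3 → Dual ℝ (RigDom d n) :=
  let h := edgeVec d Λ (fun _ : Unit => c) (fun _ => qm) (fun _ => qp) ()
  ![∑ r, h r • (pF d n j r - pF d n i r),
    ∑ r, h r • ((∑ s, qp s • aF d n k j r s) - (∑ s, qm s • aF d n k i r s)),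
    ∑ r, h r • ∑ t, (Λ.mulVec (fun s => (c s : ℝ))) t • symF d n s(r, t)]

theorem comp3_sum_apply (d n k : ℕ) (i j : Fin n) (Λ : Matrix (Fin d) (Fin d) ℝ)
    (c : Fin d → ℤ) (qm qp : Fin d → ℝ) (x : RigDom d n) :
    (∑ a, comp3 d n k i j Λ c qm qp a) x =
      (((x.2.2 + x.2.2ᵀ) * Λ).mulVec (fun r => (c r : ℝ))
      + (restrictedSkew d k (x.2.1 j)).mulVec qp
      - (restrictedSkew d k (x.2.1 i)).mulVec qm
      + x.1 j - x.1 i) ⬝ᵥ edgeVec d Λ (fun _ : Unit => c) (fun _ => qm) (fun _ => qp) () := by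
  rw [← Matrix.mulVec_mulVec]
  generalize hu : Λ.mulVec (fun r => (c r : ℝ)) = u
  simp only [comp3, hu, Fin.sum_univ_three, Matrix.cons_val_zero, Matrix.cons_val_one,
    Matrix.cons_val, LinearMap.add_apply, LinearMap.sum_apply, LinearMap.smul_apply,
    LinearMap.sub_apply, pF_apply, aF_apply, lF_apply, symF_mk, smul_eq_mul]
  simp only [dotProduct, Matrix.mulVec, Pi.add_apply, Pi.sub_apply, Matrix.add_apply,
    Matrix.transpose_apply, ← Finset.sum_add_distrib]
  refine Finset.sum_congr rfl fun r _ => ?_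
  simp only [mul_comm (x.2.2 _ _ + _) _, mul_comm (restrictedSkew _ _ _ _ _) _,
    mul_add, Finset.sum_add_distrib]
  ring

theorem comp3_indep {d k n : ℕ} {E : Type*} [Fintype E] [DecidableEq E] (tail head : E → Fin n)
    (Λ : Matrix (Fin d) (Fin d) ℝ) (c : E → Fin d → ℤ) (qm qp : E → Fin d → ℝ)
    (hΛ : IsUnit Λ) (hatt : IsMixedAttachment d n (fun _ => k) tail head qm qp)
    (hli : LinearIndependent ℝ
      (fun e => rowF d n k (tail e) (head e) Λ (c e) (qm e) (qp e))) :
    LinearIndependent ℝ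
      (fun e => ∑ a, comp3 d n k (tail e) (head e) Λ (c e) (qm e) (qp e) a) := by
  rw [aux_indep_iff_surj, LinearMap.range_eq_top] at hli ⊢
  intro y
  obtain ⟨x, hx⟩ := hli y
  obtain ⟨p, B, L⟩ := x
  let Z := L * Λ⁻¹
  let S := (1/2 : ℝ) • (Z - Zᵀ)
  have hS : Sᵀ = -S := by
    simp only [S, Matrix.transpose_smul, Matrix.transpose_sub, Matrix.transpose_transpose]
    rw [← smul_neg, neg_sub]
  have hL : L = Z * Λ := by
    simp only [Z]
    rw [Matrix.mul_assoc, Matrix.nonsing_inv_mul _ ((Matrix.isUnit_iff_isUnit_det _).1 hΛ),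
      Matrix.mul_one]
  refine ⟨(p, fun v => B v + (-1 : ℝ) • ((1/2 : ℝ) • S), (1/2 : ℝ) • Z), ?_⟩
  rw [← hx]
  funext e
  simp only [LinearMap.pi_apply]
  rw [comp3_sum_apply, ← rowF_apply d n k tail head Λ c qm qp]
  simp only [mixedRowVal, aux_rs_add, aux_rs_smul d k (-1), Matrix.add_mulVec,
    Matrix.smul_mulVec]
  rw [aux_rs_mulVec d k S hS _ (fun r hr => (hatt e r).2 hr),
    aux_rs_mulVec d k S hS _ (fun r hr => (hatt e r).1 hr)]
  have hZ : ((1/2 : ℝ) • Z + ((1/2 : ℝ) • Z)ᵀ) = Z - S := by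
    ext r s
    simp only [S, Matrix.transpose_smul, Matrix.add_apply, Matrix.sub_apply, Matrix.smul_apply,
      smul_eq_mul, Matrix.transpose_apply]
    ring
  rw [hZ, hL]
  have hd := aux_skew_dot d S hS (edgeVec d Λ c qm qp e)
  have he : edgeVec d Λ (fun _ : Unit => c e) (fun _ => qm e) (fun _ => qp e) ()
    = edgeVec d Λ c qm qp e := rfl
  rw [he]
  have hh : S.mulVec (edgeVec d Λ c qm qp e) = (S * Λ).mulVec (fun r => (c e r : ℝ))
      + S.mulVec (qp e) - S.mulVec (qm e) := by
    simp only [edgeVec, Matrix.mulVec_sub, Matrix.mulVec_add, Matrix.mulVec_mulVec]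
  rw [hh] at hd
  simp only [add_dotProduct, sub_dotProduct, smul_dotProduct, smul_eq_mul, Matrix.sub_mul,
    Matrix.sub_mulVec] at hd ⊢
  linarith

theorem aF_mem_span (d n k : ℕ) (U : Finset (Fin n)) (v : Fin n) (hv : v ∈ U) (r s : Fin d) :
    aF d n k v r s ∈ Submodule.span ℝ
      ((fun p : Fin n × (Fin d × Fin d) => aF d n k p.1 p.2.1 p.2.2) '' ↑(U ×ˢ KP d k)) := by
  have base : ∀ a b : Fin d, a < b → aF d n k v a b ∈ Submodule.span ℝ
      ((fun p : Fin n × (Fin d × Fin d) => aF d n k p.1 p.2.1 p.2.2) '' ↑(U ×ˢ KP d k)) := by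
    intro a b hab
    by_cases ha : (a : ℕ) < k
    · apply Submodule.subset_span
      refine ⟨(v, (a, b)), ?_, rfl⟩
      simp [KP, hv, hab, ha]
    · rw [aF_big d n k v a b (not_lt.1 ha) ((not_lt.1 ha).trans hab.le)]
      exact Submodule.zero_mem _
  rcases lt_trichotomy r s with h | h | h
  · exact base r s h
  · subst h; rw [aF_self]; exact Submodule.zero_mem _
  · rw [aF_swap]; exact Submodule.neg_mem _ (base s r h)

theorem forward {d k n : ℕ} (hk : k ≤ d) (hn : 1 ≤ n)
    {E : Type*} [Fintype E] [DecidableEq E] (tail head : E → Fin n)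
    (hE : Fintype.card E + (d + 1).choose 2 =
      (d * (k + 1) - (k + 1).choose 2) * n + d ^ 2)
    (Λ : Matrix (Fin d) (Fin d) ℝ) (c : E → Fin d → ℤ) (qm qp : E → Fin d → ℝ)
    (hΛ : IsUnit Λ) (hatt : IsMixedAttachment d n (fun _ => k) tail head qm qp)
    (hli : LinearIndependent ℝ
      (fun e => rowF d n k (tail e) (head e) Λ (c e) (qm e) (qp e))) :
    ∃ F₁ F₂ : Finset E, Disjoint F₁ F₂ ∧
          Tight tail head d (-(d : ℤ)) F₁ ∧
          Tight tail head (d * k - (k + 1).choose 2) 0 F₂ := by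
  obtain ⟨ρ, hρ⟩ := aux_select_sum _ (comp3_indep tail head Λ c qm qp hΛ hatt hli)
  have s1 : Sparse tail head d (-(d : ℤ)) (Finset.univ.filter fun e => ρ e = 0) := by
    intro U hU
    obtain ⟨v0, hv0⟩ := hU
    have := aux_card_le hρ
      ((Finset.univ.filter fun e => ρ e = 0).filter fun e => tail e ∈ U ∧ head e ∈ U)
      ((U.erase v0) ×ˢ (Finset.univ : Finset (Fin d)))
      (fun p => pF d n p.1 p.2 - pF d n v0 p.2) ?_
    · rw [Finset.card_product, Finset.card_univ, Fintype.card_fin] at this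
      have h2 := Finset.card_erase_add_one hv0
      zify at this h2
      rw [← h2]
      linarith
    · intro e he
      simp only [Finset.mem_filter, Finset.mem_univ, true_and] at he
      obtain ⟨h0, ht, hh⟩ := he
      simp only [h0]
      have base : ∀ v ∈ U, ∀ r, pF d n v r - pF d n v0 r ∈ Submodule.span ℝ
          ((fun p : Fin n × Fin d => pF d n p.1 p.2 - pF d n v0 p.2) ''
            ↑((U.erase v0) ×ˢ (Finset.univ : Finset (Fin d)))) := by
        intro v hv r
        by_cases hvv : v = v0
        · subst hvv; rw [sub_self]; exact Submodule.zero_mem _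
        · apply Submodule.subset_span
          exact ⟨(v, r), by simp [hv, hvv], rfl⟩
      change (∑ r, _ • (pF d n (head e) r - pF d n (tail e) r)) ∈ _
      refine Submodule.sum_mem _ fun r _ => Submodule.smul_mem _ _ ?_
      have := Submodule.sub_mem _ (base _ hh r) (base _ ht r)
      rwa [sub_sub_sub_cancel_right] at this
  have s2 : Sparse tail head (d * k - (k + 1).choose 2) 0
      (Finset.univ.filter fun e => ρ e = 1) := by
    intro U hU
    have := aux_card_le hρ
      ((Finset.univ.filter fun e => ρ e = 1).filter fun e => tail e ∈ U ∧ head e ∈ U)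
      (U ×ˢ KP d k)
      (fun p => aF d n k p.1 p.2.1 p.2.2) ?_
    · rw [Finset.card_product, KP_card d k hk] at this
      rw [add_zero, mul_comm]
      exact_mod_cast this
    · intro e he
      simp only [Finset.mem_filter, Finset.mem_univ, true_and] at he
      obtain ⟨h0, ht, hh⟩ := he
      simp only [h0]
      change (∑ r, _ • ((∑ s, qp e s • aF d n k (head e) r s)
        - (∑ s, qm e s • aF d n k (tail e) r s))) ∈ _
      refine Submodule.sum_mem _ fun r _ => Submodule.smul_mem _ _ ?_
      refine Submodule.sub_mem _ ?_ ?_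
      · exact Submodule.sum_mem _ fun s _ =>
          Submodule.smul_mem _ _ (aF_mem_span d n k U _ hh r s)
      · exact Submodule.sum_mem _ fun s _ =>
          Submodule.smul_mem _ _ (aF_mem_span d n k U _ ht r s)
  have s3 : (Finset.univ.filter fun e => ρ e = 2).card ≤ (d + 1).choose 2 := by
    have := aux_card_le hρ (Finset.univ.filter fun e => ρ e = 2)
      (Finset.univ : Finset (Sym2 (Fin d))) (symF d n) ?_
    · rw [Finset.card_univ, Sym2.card, Fintype.card_fin] at this
      exact this
    · intro e he
      simp only [Finset.mem_filter, Finset.mem_univ, true_and] at he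
      simp only [he]
      change (∑ r, _ • ∑ t, _ • symF d n s(r, t)) ∈ _
      refine Submodule.sum_mem _ fun r _ => Submodule.smul_mem _ _ ?_
      refine Submodule.sum_mem _ fun t _ => Submodule.smul_mem _ _ ?_
      exact Submodule.subset_span ⟨_, by simp, rfl⟩
  have hne : (Finset.univ : Finset (Fin n)).Nonempty := ⟨⟨0, hn⟩, Finset.mem_univ _⟩
  have c1 := s1 Finset.univ hne
  have c2 := s2 Finset.univ hne
  simp only [Finset.mem_univ, and_self, Finset.filter_true, Finset.card_univ,
    Fintype.card_fin] at c1 c2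
  have hsum : Fintype.card E = (Finset.univ.filter fun e => ρ e = 0).card
      + (Finset.univ.filter fun e => ρ e = 1).card
      + (Finset.univ.filter fun e => ρ e = 2).card := by
    rw [← Finset.card_univ, Finset.card_eq_sum_card_fiberwise (f := ρ) (t := Finset.univ)
      (by intro x _; simp), Fin.sum_univ_three]
  have hkk := KP_card_add d k hk
  have hsplit : d * (k + 1) - (k + 1).choose 2 = d + (d * k - (k + 1).choose 2) := by
    rw [Nat.mul_succ]; omega
  have hch : (d + 1).choose 2 + (d + 1).choose 2 = d ^ 2 + d := by
    have := Nat.triangle_succ d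
    rw [Nat.choose_two_right]
    have h2 : 2 ∣ (d + 1) * (d + 1 - 1) := (Nat.even_mul_pred_self (d+1)).two_dvd
    have h3 := Nat.div_mul_cancel h2
    have h4 : (d + 1) * (d + 1 - 1) = d ^ 2 + d := by simp; ring
    omega
  rw [hsplit, add_mul] at hE
  refine ⟨Finset.univ.filter fun e => ρ e = 0, Finset.univ.filter fun e => ρ e = 1, ?_,
    ⟨s1, ?_⟩, ⟨s2, ?_⟩⟩
  · rw [Finset.disjoint_filter]
    intro e _ h
    rw [h]; decide
  · rw [Fintype.card_fin]
    zify at hE hsum hch s3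
    linarith
  · rw [Fintype.card_fin]
    zify at hE hsum hch s3
    linarith

end Forward

section Backward
open Module

/-- Difference functional of the translation parts. -/
noncomputable def dF (d n : ℕ) (i j : Fin n) (r : Fin d) : Dual ℝ (Fin n → Fin d → ℝ) where
  toFun p := p j r - p i r
  map_add' x y := by simp only [Pi.add_apply]; ring
  map_smul' a x := by simp only [Pi.smul_apply, smul_eq_mul, RingHom.id_apply]; ring

theorem dF_apply (d n : ℕ) (i j : Fin n) (r : Fin d) (p : Fin n → Fin d → ℝ) :
    dF d n i j r p = p j r - p i r := rfl

theorem sparse_indep {d n : ℕ} {E : Type*} [Fintype E] [DecidableEq E] (tail head : E → Fin n)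
    (F : Finset E) (hF : Sparse tail head d (-(d : ℤ)) F) :
    ∃ ρ : F → Fin d, LinearIndependent ℝ
      (fun e : F => dF d n (tail e.1) (head e.1) (ρ e)) := by
  classical
  have hcond : ∀ S : Finset F, S.card ≤ finrank ℝ (Submodule.span ℝ (((S.biUnion fun e : F =>
      Finset.univ.image (fun r => dF d n (tail e.1) (head e.1) r)) :
        Finset (Dual ℝ (Fin n → Fin d → ℝ))) : Set (Dual ℝ (Fin n → Fin d → ℝ)))) := by
    intro S
    set A := Submodule.span ℝ (((S.biUnion fun e : F =>
      Finset.univ.image (fun r => dF d n (tail e.1) (head e.1) r)) :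
        Finset (Dual ℝ (Fin n → Fin d → ℝ))) : Set (Dual ℝ (Fin n → Fin d → ℝ))) with hA
    let Q := Quot (fun i j : Fin n => ∃ e ∈ S, tail e.1 = i ∧ head e.1 = j)
    let mk : Fin n → Q := Quot.mk _
    haveI : Fintype Q := Fintype.ofSurjective mk Quot.mk_surjective
    let L : (Q → Fin d → ℝ) →ₗ[ℝ] (Fin n → Fin d → ℝ) := LinearMap.funLeft ℝ _ mk
    have hco : Submodule.dualCoannihilator A ≤ LinearMap.range L := by
      intro p hp
      rw [Submodule.mem_dualCoannihilator] at hp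
      refine ⟨Quot.lift p ?_, ?_⟩
      · rintro i j ⟨e, he, rfl, rfl⟩
        funext r
        have h := hp (dF d n (tail e.1) (head e.1) r) (Submodule.subset_span (by
          rw [Finset.mem_coe, Finset.mem_biUnion]
          exact ⟨e, he, Finset.mem_image_of_mem _ (Finset.mem_univ r)⟩))
        rw [dF_apply] at h
        linarith
      · funext v
        rfl
    have h1 := Submodule.finrank_mono hco
    have h2 := LinearMap.finrank_range_le L
    have h3 := Subspace.finrank_add_finrank_dualCoannihilator_eq A
    have h4 : finrank ℝ (Q → Fin d → ℝ) = Fintype.card Q * d := by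
      simp [Module.finrank_pi_fintype]
    have h5 : finrank ℝ (Fin n → Fin d → ℝ) = n * d := by
      simp [Module.finrank_pi_fintype]
    have hcount : (S.card : ℤ) ≤ d * n - d * Fintype.card Q := by
      have e1 : S.card = ∑ q : Q, (S.filter fun e : F => mk (tail e.1) = q).card :=
        Finset.card_eq_sum_card_fiberwise (f := fun e : F => mk (tail e.1))
          (t := (Finset.univ : Finset Q)) (by intro x _; simp)
      have e2 : n = ∑ q : Q, ((Finset.univ : Finset (Fin n)).filter fun v => mk v = q).card := by
        have := Finset.card_eq_sum_card_fiberwise (f := mk)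
          (s := (Finset.univ : Finset (Fin n)))
          (t := (Finset.univ : Finset Q)) (by intro x _; simp)
        simpa using this
      have e3 : ∀ q : Q, ((S.filter fun e : F => mk (tail e.1) = q).card : ℤ) ≤
          d * ((Finset.univ : Finset (Fin n)).filter fun v => mk v = q).card + -(d : ℤ) := by
        intro q
        have hne : ((Finset.univ : Finset (Fin n)).filter fun v => mk v = q).Nonempty := by
          obtain ⟨v, hv⟩ := Quot.mk_surjective q
          exact ⟨v, by simpa using hv⟩
        refine le_trans ?_ (hF _ hne)
        rw [← Finset.card_map (Function.Embedding.subtype (· ∈ F))]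
        norm_cast
        apply Finset.card_le_card
        intro e he
        simp only [Finset.mem_map, Finset.mem_filter, Function.Embedding.subtype_apply] at he
        obtain ⟨a, ⟨ha, haq⟩, rfl⟩ := he
        simp only [Finset.mem_filter, Finset.mem_univ, true_and]
        refine ⟨a.2, haq, ?_⟩
        rw [← haq]
        exact (Quot.sound ⟨a, ha, rfl, rfl⟩).symm
      have e4 := Finset.sum_le_sum (s := Finset.univ) (fun q _ => e3 q)
      rw [Finset.sum_add_distrib, ← Finset.mul_sum, Finset.sum_const, Finset.card_univ] at e4
      rw [← Nat.cast_sum, ← Nat.cast_sum, ← e1, ← e2] at e4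
      rw [nsmul_eq_mul] at e4
      linarith
    rw [h4] at h2
    rw [h5] at h3
    zify at h1 h2 h3 ⊢
    linarith
  obtain ⟨w, hw, hli⟩ := aux_rado (ι := F) (V := Dual ℝ (Fin n → Fin d → ℝ)) _
    (fun e => Finset.univ.image (fun r => dF d n (tail e.1) (head e.1) r)) rfl hcond
  simp only [Finset.mem_image, Finset.mem_univ, true_and] at hw
  choose ρ hρ using hw
  refine ⟨ρ, ?_⟩
  have : (fun e : F => dF d n (tail e.1) (head e.1) (ρ e)) = w := funext hρ
  rw [this]; exact hli

theorem sparse_assign {n m : ℕ} {E K : Type*} [Fintype E] [DecidableEq E] [Fintype K]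
    [DecidableEq K] (hK : Fintype.card K = m)
    (tail head : E → Fin n) (F : Finset E) (hF : Sparse tail head m 0 F) :
    ∃ α : F → Fin n × K, Function.Injective α ∧
      ∀ e : F, (α e).1 = tail e.1 ∨ (α e).1 = head e.1 := by
  classical
  have := (Finset.all_card_le_biUnion_card_iff_exists_injective
    (fun e : F => ({tail e.1, head e.1} : Finset (Fin n)) ×ˢ (Finset.univ : Finset K))).1 ?_
  · obtain ⟨f, hf, hm⟩ := this
    refine ⟨f, hf, fun e => ?_⟩
    have := hm e
    simpa using this
  · intro S
    rcases S.eq_empty_or_nonempty with rfl | ⟨e0, he0⟩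
    · simp
    have h1 : S.biUnion (fun e : F =>
        ({tail e.1, head e.1} : Finset (Fin n)) ×ˢ (Finset.univ : Finset K))
        = (S.biUnion fun e : F => ({tail e.1, head e.1} : Finset (Fin n))) ×ˢ
          (Finset.univ : Finset K) := by
      ext ⟨a, b⟩
      simp
    rw [h1, Finset.card_product, Finset.card_univ, hK]
    have h2 := hF (S.biUnion fun e : F => ({tail e.1, head e.1} : Finset (Fin n)))
      ⟨tail e0.1, Finset.mem_biUnion.2 ⟨e0, he0, by simp⟩⟩
    have h3 : S.card ≤ (F.filter fun e =>
        tail e ∈ (S.biUnion fun e : F => ({tail e.1, head e.1} : Finset (Fin n))) ∧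
        head e ∈ (S.biUnion fun e : F => ({tail e.1, head e.1} : Finset (Fin n)))).card := by
      rw [← Finset.card_map (Function.Embedding.subtype (· ∈ F))]
      apply Finset.card_le_card
      intro e he
      simp only [Finset.mem_map, Function.Embedding.subtype_apply] at he
      obtain ⟨a, ha, rfl⟩ := he
      rw [Finset.mem_filter]
      exact ⟨a.2, Finset.mem_biUnion.2 ⟨a, ha, by simp⟩, Finset.mem_biUnion.2 ⟨a, ha, by simp⟩⟩
    zify at h3 ⊢
    linarith

/-- The set of rows an edge can take with identity lattice. -/
def rowSet (d n k : ℕ) (i j : Fin n) : Set (Dual ℝ (RigDom d n)) :=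
  {f | ∃ (c : Fin d → ℤ) (qm qp : Fin d → ℝ),
    (∀ r : Fin d, (k ≤ (r : ℕ) → qm r = 0) ∧ (k ≤ (r : ℕ) → qp r = 0)) ∧
    f = rowF d n k i j 1 c qm qp}

theorem rowF_one_apply (d n k : ℕ) (i j : Fin n)
    (c : Fin d → ℤ) (qm qp : Fin d → ℝ) (x : RigDom d n) :
    rowF d n k i j 1 c qm qp x =
    (x.2.2.mulVec (fun r => (c r : ℝ))
      + (restrictedSkew d k (x.2.1 j)).mulVec qp
      - (restrictedSkew d k (x.2.1 i)).mulVec qm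
      + x.1 j - x.1 i) ⬝ᵥ ((fun r => (c r : ℝ)) + qp - qm) := by
  rw [← rowF_apply d n k (fun _ : Unit => i) (fun _ => j) 1 (fun _ => c) (fun _ => qm)
    (fun _ => qp) x ()]
  simp only [mixedRowVal, edgeVec, Matrix.one_mulVec]

theorem span_quad (d n k : ℕ) (i j : Fin n) (c : Fin d → ℤ) (f : Dual ℝ (RigDom d n))
    (hf : ∀ x, f x = (x.2.2.mulVec (fun r => (c r : ℝ))) ⬝ᵥ (fun r => (c r : ℝ))) :
    f ∈ Submodule.span ℝ (rowSet d n k i j) := by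
  have h1 : rowF d n k i j 1 c 0 0 ∈ Submodule.span ℝ (rowSet d n k i j) :=
    Submodule.subset_span ⟨c, 0, 0, by simp, rfl⟩
  have h2 : rowF d n k i j 1 (-c) 0 0 ∈ Submodule.span ℝ (rowSet d n k i j) :=
    Submodule.subset_span ⟨-c, 0, 0, by simp, rfl⟩
  have : f = (1/2 : ℝ) • (rowF d n k i j 1 c 0 0 + rowF d n k i j 1 (-c) 0 0) := by
    refine LinearMap.ext fun x => ?_
    rw [LinearMap.smul_apply, LinearMap.add_apply, rowF_one_apply, rowF_one_apply, hf]
    have hc : (fun r => (((-c) r : ℤ) : ℝ)) = -(fun r => (c r : ℝ)) := by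
      funext r; simp
    rw [hc]
    simp only [Matrix.mulVec_zero, Matrix.mulVec_neg, add_zero, sub_zero, add_dotProduct,
      sub_dotProduct, neg_dotProduct, dotProduct_neg, smul_eq_mul]
    ring
  rw [this]
  exact Submodule.smul_mem _ _ (Submodule.add_mem _ h1 h2)

theorem int_single (d : ℕ) (r : Fin d) :
    (fun t => (((Pi.single r 1 : Fin d → ℤ) t : ℤ) : ℝ)) = Pi.single r (1:ℝ) := by
  funext t
  by_cases h : t = r
  · subst h; simp
  · simp [h]

theorem span_diff (d n k : ℕ) (i j : Fin n) (r : Fin d) :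
    pF d n j r - pF d n i r ∈ Submodule.span ℝ (rowSet d n k i j) := by
  have h1 : rowF d n k i j 1 (Pi.single r 1) 0 0 ∈ Submodule.span ℝ (rowSet d n k i j) :=
    Submodule.subset_span ⟨_, 0, 0, by simp, rfl⟩
  have h2 : rowF d n k i j 1 (-(Pi.single r 1)) 0 0 ∈ Submodule.span ℝ (rowSet d n k i j) :=
    Submodule.subset_span ⟨_, 0, 0, by simp, rfl⟩
  have : pF d n j r - pF d n i r = (1/2 : ℝ) • (rowF d n k i j 1 (Pi.single r 1) 0 0
      - rowF d n k i j 1 (-(Pi.single r 1)) 0 0) := by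
    refine LinearMap.ext fun x => ?_
    rw [LinearMap.smul_apply, LinearMap.sub_apply, LinearMap.sub_apply, rowF_one_apply,
      rowF_one_apply, pF_apply, pF_apply]
    have hc : (fun t => (((-(Pi.single r 1 : Fin d → ℤ)) t : ℤ) : ℝ))
        = -(Pi.single r (1:ℝ)) := by
      rw [← int_single]; funext t; simp
    rw [hc, int_single]
    simp only [Matrix.mulVec_zero, Matrix.mulVec_neg, add_zero, sub_zero, add_dotProduct,
      sub_dotProduct, neg_dotProduct, dotProduct_neg, smul_eq_mul, dotProduct_single, mul_one,
      Pi.add_apply, Pi.sub_apply, Pi.neg_apply]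
    ring
  rw [this]
  exact Submodule.smul_mem _ _ (Submodule.sub_mem _ h1 h2)

theorem span_diag (d n k : ℕ) (i j : Fin n) (r : Fin d) :
    lF d n r r ∈ Submodule.span ℝ (rowSet d n k i j) := by
  apply span_quad d n k i j (Pi.single r 1)
  intro x
  rw [int_single, lF_apply]
  simp

theorem span_sym (d n k : ℕ) (i j : Fin n) (z : Sym2 (Fin d)) :
    symF d n z ∈ Submodule.span ℝ (rowSet d n k i j) := by
  induction z using Sym2.ind with
  | _ r s =>
  have h : symF d n s(r, s) + lF d n r r + lF d n s s ∈
      Submodule.span ℝ (rowSet d n k i j) := by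
    apply span_quad d n k i j (Pi.single r 1 + Pi.single s 1)
    intro x
    have hc : (fun t => (((Pi.single r 1 + Pi.single s 1 : Fin d → ℤ) t : ℤ) : ℝ))
        = Pi.single r (1:ℝ) + Pi.single s (1:ℝ) := by
      rw [← int_single, ← int_single]; funext t; simp
    rw [hc, symF_mk]
    simp only [LinearMap.add_apply, lF_apply, Matrix.mulVec_add, dotProduct_add, add_dotProduct,
      dotProduct_single, mul_one, Matrix.mulVec_single, MulOpposite.op_one, one_smul,
      Matrix.col_apply, Pi.add_apply]
    ring
  have h2 := Submodule.sub_mem _ (Submodule.sub_mem _ h (span_diag d n k i j s))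
    (span_diag d n k i j r)
  rwa [add_sub_cancel_right, add_sub_cancel_right] at h2

theorem span_rot (d n k : ℕ) (i j v : Fin n) (hv : v = i ∨ v = j) (r s : Fin d)
    (hs : (s : ℕ) < k) :
    lF d n s r + aF d n k v r s ∈ Submodule.span ℝ (rowSet d n k i j) := by
  have hq : ∀ t : Fin d, k ≤ (t : ℕ) → (Pi.single s (1:ℝ) : Fin d → ℝ) t = 0 := by
    intro t ht
    rw [Pi.single_eq_of_ne]
    rintro rfl
    omega
  have hself : ∀ w, ∀ x : RigDom d n, restrictedSkew d k (x.2.1 w) s s = 0 := by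
    intro w x
    have := aF_self d n k w s
    rw [← aF_apply, this]; rfl
  have D1 := span_diag d n k i j r
  have D2 := span_diff d n k i j r
  have D3 := span_diff d n k i j s
  rcases hv with rfl | rfl
  · have h1 : rowF d n k v j 1 (Pi.single r 1) (Pi.single s 1) 0
        ∈ Submodule.span ℝ (rowSet d n k v j) :=
      Submodule.subset_span ⟨_, _, _, fun t => ⟨hq t, fun _ => rfl⟩, rfl⟩
    have : lF d n s r + aF d n k v r s = lF d n r r + (pF d n j r - pF d n v r)
        - (pF d n j s - pF d n v s)
        - rowF d n k v j 1 (Pi.single r 1) (Pi.single s 1) 0 := by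
      refine LinearMap.ext fun x => ?_
      simp only [LinearMap.add_apply, LinearMap.sub_apply]
      rw [rowF_one_apply, int_single]
      simp only [lF_apply, aF_apply, pF_apply, Matrix.mulVec_zero, dotProduct_add, dotProduct_sub,
        dotProduct_single, mul_one, Matrix.mulVec_single, MulOpposite.op_one, one_smul,
        Matrix.col_apply, dotProduct_zero, zero_dotProduct, hself,
        Pi.add_apply, Pi.sub_apply, Pi.zero_apply]
      ring
    rw [this]
    exact Submodule.sub_mem _ (Submodule.sub_mem _ (Submodule.add_mem _ D1 D2) D3) h1
  · have h1 : rowF d n k i v 1 (Pi.single r 1) 0 (Pi.single s 1)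
        ∈ Submodule.span ℝ (rowSet d n k i v) :=
      Submodule.subset_span ⟨_, _, _, fun t => ⟨fun _ => rfl, hq t⟩, rfl⟩
    have : lF d n s r + aF d n k v r s = rowF d n k i v 1 (Pi.single r 1) 0 (Pi.single s 1)
        - lF d n r r - (pF d n v r - pF d n i r) - (pF d n v s - pF d n i s) := by
      refine LinearMap.ext fun x => ?_
      simp only [LinearMap.add_apply, LinearMap.sub_apply]
      rw [rowF_one_apply, int_single]
      simp only [lF_apply, aF_apply, pF_apply, Matrix.mulVec_zero, dotProduct_add, dotProduct_sub,
        dotProduct_single, mul_one, Matrix.mulVec_single, MulOpposite.op_one, one_smul,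
        Matrix.col_apply, dotProduct_zero, zero_dotProduct, hself,
        Pi.add_apply, Pi.sub_apply, Pi.zero_apply]
      ring
    rw [this]
    exact Submodule.sub_mem _ (Submodule.sub_mem _ (Submodule.sub_mem _ h1 D1) D2) D3

end Backward

section BackwardMain
open Module

theorem symF_single (d n : ℕ) (r s : Fin d) (z : Sym2 (Fin d)) :
    (z ≠ s(r, s) → symF d n z (0, 0, Matrix.single r s 1) = 0) ∧
    (z = s(r, s) → symF d n z (0, 0, Matrix.single r s 1) ≠ 0) := by
  induction z using Sym2.ind with
  | _ a b =>
  rw [symF_mk, LinearMap.add_apply, lF_apply, lF_apply]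
  simp only [Matrix.single_apply, ne_eq, Sym2.eq_iff]
  constructor
  · intro h
    rw [not_or] at h
    rw [if_neg (fun h' => h.1 ⟨h'.1.symm, h'.2.symm⟩),
      if_neg (fun h' => h.2 ⟨h'.2.symm, h'.1.symm⟩), add_zero]
  · rintro (⟨rfl, rfl⟩ | ⟨rfl, rfl⟩)
    · by_cases h : a = b <;> simp [h]
    · by_cases h : a = b <;> simp [h]

theorem rs_single (d k : ℕ) (p p' : KP d k) :
    restrictedSkew d k (Matrix.single p.1.2 p.1.1 1) p'.1.2 p'.1.1 = if p' = p then 1 else 0 := by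
  obtain ⟨⟨a, b⟩, hp⟩ := p
  obtain ⟨⟨a', b'⟩, hp'⟩ := p'
  simp only [KP, Finset.mem_filter, Finset.mem_univ, true_and] at hp hp'
  simp only [restrictedSkew, Matrix.of_apply, Matrix.single_apply, Subtype.mk.injEq,
    Prod.mk.injEq]
  rw [if_neg (by omega), if_neg (c := b = a' ∧ a = b') (by
    rintro ⟨rfl, rfl⟩
    exact absurd (hp.1.trans hp'.1) (lt_irrefl _)), sub_zero]
  by_cases h : b = b' ∧ a = a'
  · rw [if_pos h, if_pos ⟨h.2.symm, h.1.symm⟩]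
  · rw [if_neg h, if_neg (fun h' => h ⟨h'.2.symm, h'.1.symm⟩)]

theorem backward {d k n : ℕ} (hk : k ≤ d)
    {E : Type*} [Fintype E] [DecidableEq E] (tail head : E → Fin n)
    (hE : Fintype.card E + (d + 1).choose 2 =
      (d * (k + 1) - (k + 1).choose 2) * n + d ^ 2)
    (F₁ F₂ : Finset E) (hdis : Disjoint F₁ F₂)
    (hF1 : Tight tail head d (-(d : ℤ)) F₁)
    (hF2 : Tight tail head (d * k - (k + 1).choose 2) 0 F₂) :
    ∃ w : E → Dual ℝ (RigDom d n), LinearIndependent ℝ w ∧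
      ∀ e, w e ∈ Submodule.span ℝ (rowSet d n k (tail e) (head e)) := by
  obtain ⟨ρ, hρ⟩ := sparse_indep tail head F₁ hF1.1
  obtain ⟨α, hα, hαe⟩ := sparse_assign (K := KP d k)
    (by rw [Fintype.card_coe]; exact KP_card d k hk) tail head F₂ hF2.1
  have hcard : ((F₁ ∪ F₂)ᶜ).card = (d + 1).choose 2 := by
    have h1 := Finset.card_add_card_compl (F₁ ∪ F₂)
    rw [Finset.card_union_of_disjoint hdis] at h1
    have h2 := hF1.2
    have h3 := hF2.2
    rw [Fintype.card_fin] at h2 h3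
    have hkk := KP_card_add d k hk
    have hsplit : d * (k + 1) - (k + 1).choose 2 = d + (d * k - (k + 1).choose 2) := by
      rw [Nat.mul_succ]; omega
    have hch : (d + 1).choose 2 + (d + 1).choose 2 = d ^ 2 + d := by
      rw [Nat.choose_two_right]
      have h2 : 2 ∣ (d + 1) * (d + 1 - 1) := (Nat.even_mul_pred_self (d+1)).two_dvd
      have h3 := Nat.div_mul_cancel h2
      have h4 : (d + 1) * (d + 1 - 1) = d ^ 2 + d := by simp; ring
      omega
    rw [hsplit, add_mul] at hE
    zify at hE hch h1 ⊢
    linarith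
  obtain ⟨β⟩ : Nonempty (((F₁ ∪ F₂)ᶜ : Finset E) ↪ Sym2 (Fin d)) := by
    apply Function.Embedding.nonempty_of_card_le
    rw [Fintype.card_coe, hcard, Sym2.card, Fintype.card_fin]
  have h3mem : ∀ e, e ∉ F₁ → e ∉ F₂ → e ∈ (F₁ ∪ F₂)ᶜ := by
    intro e h1 h2
    simp [h1, h2]
  let w : E → Dual ℝ (RigDom d n) := fun e =>
    if h1 : e ∈ F₁ then pF d n (head e) (ρ ⟨e, h1⟩) - pF d n (tail e) (ρ ⟨e, h1⟩)
    else if h2 : e ∈ F₂ then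
      lF d n (α ⟨e, h2⟩).2.1.1 (α ⟨e, h2⟩).2.1.2
        + aF d n k (α ⟨e, h2⟩).1 (α ⟨e, h2⟩).2.1.2 (α ⟨e, h2⟩).2.1.1
    else symF d n (β ⟨e, h3mem e h1 h2⟩)
  have w1 : ∀ e (h1 : e ∈ F₁), w e =
      pF d n (head e) (ρ ⟨e, h1⟩) - pF d n (tail e) (ρ ⟨e, h1⟩) := by
    intro e h1; simp only [w, dif_pos h1]
  have w2 : ∀ e (h2 : e ∈ F₂), w e = lF d n (α ⟨e, h2⟩).2.1.1 (α ⟨e, h2⟩).2.1.2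
        + aF d n k (α ⟨e, h2⟩).1 (α ⟨e, h2⟩).2.1.2 (α ⟨e, h2⟩).2.1.1 := by
    intro e h2
    have h1 : e ∉ F₁ := fun h => Finset.disjoint_left.1 hdis h h2
    simp only [w, dif_neg h1, dif_pos h2]
  have w3 : ∀ e (h1 : e ∉ F₁) (h2 : e ∉ F₂), w e = symF d n (β ⟨e, h3mem e h1 h2⟩) := by
    intro e h1 h2; simp only [w, dif_neg h1, dif_neg h2]
  refine ⟨w, ?_, ?_⟩
  · rw [Fintype.linearIndependent_iff]
    intro g hg
    have ev : ∀ x, ∑ e, g e * w e x = 0 := by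
      intro x
      have := LinearMap.congr_fun hg x
      simpa using this
    have rs0 : restrictedSkew d k 0 = 0 := by
      ext r s; simp [restrictedSkew]
    have sym0 : ∀ z p B, symF d n z (p, B, 0) = 0 := by
      intro z p B
      induction z using Sym2.ind with
      | _ a b => rw [symF_mk, LinearMap.add_apply, lF_apply, lF_apply]; simp
    have gA : ∀ e ∈ F₂, g e = 0 := by
      intro e0 he0
      have h := ev (0, Pi.single (α ⟨e0, he0⟩).1
        (Matrix.single (α ⟨e0, he0⟩).2.1.2 (α ⟨e0, he0⟩).2.1.1 1), 0)
      rw [Finset.sum_eq_single e0] at h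
      · rw [w2 e0 he0, LinearMap.add_apply, lF_apply, aF_apply] at h
        simp only [Pi.single_eq_same] at h
        rw [rs_single] at h
        simpa using h
      · intro e _ hne
        by_cases h1 : e ∈ F₁
        · rw [w1 e h1, LinearMap.sub_apply, pF_apply, pF_apply]; simp
        by_cases h2 : e ∈ F₂
        · rw [w2 e h2, LinearMap.add_apply, lF_apply, aF_apply]
          by_cases hv : (α ⟨e, h2⟩).1 = (α ⟨e0, he0⟩).1
          · simp only [hv, Pi.single_eq_same]
            rw [rs_single, if_neg]
            · simp
            · intro hp
              have := hα (Prod.ext hv hp)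
              exact hne (congrArg Subtype.val this)
          · simp only [Pi.single_eq_of_ne hv, rs0]
            simp
        · rw [w3 e h1 h2, sym0, mul_zero]
      · simp
    have gB : ∀ e, e ∉ F₁ → e ∉ F₂ → g e = 0 := by
      intro e0 h10 h20
      obtain ⟨r, s, hrs⟩ : ∃ r s, β ⟨e0, h3mem e0 h10 h20⟩ = s(r, s) := by
        induction h : β ⟨e0, h3mem e0 h10 h20⟩ using Sym2.ind with
        | _ a b => exact ⟨a, b, rfl⟩
      have h := ev (0, 0, Matrix.single r s 1)
      rw [Finset.sum_eq_single e0] at h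
      · rw [w3 e0 h10 h20] at h
        exact (mul_eq_zero.1 h).resolve_right ((symF_single d n r s _).2 hrs)
      · intro e _ hne
        by_cases h1 : e ∈ F₁
        · rw [w1 e h1, LinearMap.sub_apply, pF_apply, pF_apply]; simp
        by_cases h2 : e ∈ F₂
        · rw [gA e h2, zero_mul]
        · rw [w3 e h1 h2, (symF_single d n r s _).1, mul_zero]
          intro hz
          rw [← hrs] at hz
          exact hne (congrArg Subtype.val (β.injective hz))
      · simp
    have gC : ∀ e : F₁, g e.1 = 0 := by
      refine Fintype.linearIndependent_iff.1 hρ (fun e : F₁ => g e.1) ?_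
      refine LinearMap.ext fun p => ?_
      have h := ev (p, 0, 0)
      rw [← Finset.sum_subset (Finset.subset_univ F₁), ← Finset.sum_coe_sort] at h
      · rw [LinearMap.sum_apply, LinearMap.zero_apply, ← h]
        refine Finset.sum_congr rfl fun e _ => ?_
        rw [w1 e.1 e.2, LinearMap.smul_apply, LinearMap.sub_apply]
        rfl
      · intro e _ h1
        by_cases h2 : e ∈ F₂
        · rw [gA e h2, zero_mul]
        · rw [gB e h1 h2, zero_mul]
    intro e
    by_cases h1 : e ∈ F₁
    · exact gC ⟨e, h1⟩
    by_cases h2 : e ∈ F₂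
    · exact gA e h2
    · exact gB e h1 h2
  · intro e
    by_cases h1 : e ∈ F₁
    · rw [w1 e h1]; exact span_diff d n k _ _ _
    by_cases h2 : e ∈ F₂
    · rw [w2 e h2]
      refine span_rot d n k _ _ _ (hαe ⟨e, h2⟩) _ _ ?_
      have := (α ⟨e, h2⟩).2.2
      simp only [KP, Finset.mem_filter] at this
      exact this.2.2
    · rw [w3 e h1 h2]; exact span_sym d n k _ _ _

end BackwardMain

/-- characterization of minimally rigid `d`-periodic frameworks of
`k`-dimensional plates connected by bars.  With constant weight `k_v = k` and
`|E| = (d(k+1) − C(k+1,2))n + d² − C(d+1,2)`, some mixed presentation has mixed rigidity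
matrix of full rank `|E|` iff `E` contains two disjoint subsets, one `(d,d)`-tight
(`|F₁| = dn − d`) and one `(dk − C(k+1,2), 0)`-tight (`|F₂| = (dk − C(k+1,2))n`). -/
theorem stmt_16 {d k n : ℕ} (hd : 1 ≤ d) (hk : k ≤ d) (hn : 1 ≤ n)
    {E : Type*} [Fintype E] [DecidableEq E] (tail head : E → Fin n)
    (hE : Fintype.card E + (d + 1).choose 2 =
      (d * (k + 1) - (k + 1).choose 2) * n + d ^ 2) :
    (∃ (Λ : Matrix (Fin d) (Fin d) ℝ) (c : E → Fin d → ℤ) (qm qp : E → Fin d → ℝ),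
        IsUnit Λ ∧ (∀ e, edgeVec d Λ c qm qp e ≠ 0) ∧
        IsMixedAttachment d n (fun _ => k) tail head qm qp ∧
        mixedRigidityRank d n (fun _ => k) tail head Λ c qm qp Finset.univ
          = Fintype.card E)
      ↔ ∃ F₁ F₂ : Finset E, Disjoint F₁ F₂ ∧
          Tight tail head d (-(d : ℤ)) F₁ ∧
          Tight tail head (d * k - (k + 1).choose 2) 0 F₂ := by
  constructor
  · rintro ⟨Λ, c, qm, qp, hΛ, _, hatt, hrank⟩
    exact forward hk hn tail head hE Λ c qm qp hΛ hatt
      ((rank_iff d n k tail head Λ c qm qp).1 hrank)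
  · rintro ⟨F₁, F₂, hdis, hF1, hF2⟩
    obtain ⟨w, hw, hspan⟩ := backward hk tail head hE F₁ F₂ hdis hF1 hF2
    obtain ⟨x, hx, hli⟩ := aux_select_span _ w hspan hw
    choose c qm qp hq hrow using hx
    have hli' : LinearIndependent ℝ
        (fun e => rowF d n k (tail e) (head e) 1 (c e) (qm e) (qp e)) := by
      have : (fun e => rowF d n k (tail e) (head e) 1 (c e) (qm e) (qp e)) = x :=
        funext fun e => (hrow e).symm
      rw [this]; exact hli
    refine ⟨1, c, qm, qp, isUnit_one, ?_, fun e r => hq e r,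
      (rank_iff d n k tail head 1 c qm qp).2 hli'⟩
    intro e he
    apply hli'.ne_zero e
    have he' : edgeVec d 1 (fun _ : Unit => c e) (fun _ => qm e) (fun _ => qp e) () = 0 := he
    simp only [rowF, he', Pi.zero_apply, zero_smul, Finset.sum_const_zero]
end

section
/- Let d ≥ 1 and let G be a multigraph on a finite vertex set V with |V| = n and edge set E with |E| = binom(d+1,2)·n − d. Then E is (binom(d+1,2), −d)-tight (i.e., every nonempty U ⊆ V spans at most binom(d+1,2)|U| − d edges) if and only if E decomposes as a disjoint union E = F₁ ⊔ F₂ where F₁ is (d,d)-tight (|F₁| = dn − d) and F₂ is (binom(d,2), 0)-tight (|F₂| = binom(d,2)·n). -/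
/-- Number of edges of `D` entering `U`. -/
def enterCount {V E : Type*} [DecidableEq V] [DecidableEq E] (t h : E → V)
    (D : Finset E) (U : Finset V) : ℕ :=
  (D.filter fun e => h e ∈ U ∧ t e ∉ U).card

/-- Number of edges of `D` spanned by `U`. -/
def spanCount {V E : Type*} [DecidableEq V] [DecidableEq E] (t h : E → V)
    (D : Finset E) (U : Finset V) : ℕ :=
  (D.filter fun e => t e ∈ U ∧ h e ∈ U).card

theorem enterCount_submod {V E : Type*} [DecidableEq V] [DecidableEq E] (t h : E → V)
    (D : Finset E) (U W : Finset V) :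
    enterCount t h D (U ∩ W) + enterCount t h D (U ∪ W)
      ≤ enterCount t h D U + enterCount t h D W := by
  unfold enterCount
  simp only [Finset.card_filter, ← Finset.sum_add_distrib]
  apply Finset.sum_le_sum
  intro e _
  simp only [Finset.mem_inter, Finset.mem_union]
  by_cases h1 : h e ∈ U <;> by_cases h2 : h e ∈ W <;> by_cases h3 : t e ∈ U <;>
    by_cases h4 : t e ∈ W <;> simp [h1, h2, h3, h4]

theorem grow_step {V E : Type*} [Fintype V] [DecidableEq V] [DecidableEq E] (t h : E → V)
    (r : V) (k : ℕ) (D : Finset E) (S : Finset V) (hr : r ∈ S) (hS : S ≠ Finset.univ)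
    (h1 : ∀ U : Finset V, U.Nonempty → r ∉ U → k ≤ enterCount t h D U)
    (h2 : ∀ U : Finset V, U.Nonempty → Disjoint U S → k + 1 ≤ enterCount t h D U) :
    ∃ e ∈ D, t e ∈ S ∧ h e ∉ S ∧
      ∀ U : Finset V, U.Nonempty → r ∉ U → k ≤ enterCount t h (D.erase e) U := by
  classical
  let P : Finset V → Prop := fun U => ¬ U ⊆ S ∧ enterCount t h D U ≤ k ∧ (U = Finset.univ ∨ r ∉ U)
  have hex : ∃ U, P U := by
    refine ⟨Finset.univ, ?_, ?_, Or.inl rfl⟩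
    · intro hh
      exact hS (Finset.univ_subset_iff.mp hh)
    · simp [enterCount]
  obtain ⟨U, hU, hmin⟩ := WellFounded.has_min (measure (Finset.card : Finset V → ℕ)).wf
    {U | P U} hex
  obtain ⟨hUS, hUk, hUr⟩ := hU
  have hne : (U \ S).Nonempty := Finset.sdiff_nonempty.mpr hUS
  have hlt : enterCount t h D U < enterCount t h D (U \ S) :=
    lt_of_le_of_lt hUk (h2 _ hne Finset.sdiff_disjoint)
  obtain ⟨e, he1, he2⟩ := Finset.exists_mem_notMem_of_card_lt_card hlt
  simp only [Finset.mem_filter, Finset.mem_sdiff, not_and, not_not] at he1 he2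
  obtain ⟨heD, ⟨hhU, hhS⟩, htU'⟩ := he1
  have htU : t e ∈ U := he2 heD hhU
  refine ⟨e, heD, htU' htU, hhS, ?_⟩
  intro W hW hrW
  have hle := h1 W hW hrW
  by_cases hent : h e ∈ W ∧ t e ∉ W
  · by_cases hc : enterCount t h D W ≤ k
    · exfalso
      refine hmin (U ∩ W) ⟨?_, ?_, ?_⟩ ?_
      · intro hh
        exact hhS (hh (Finset.mem_inter.mpr ⟨hhU, hent.1⟩))
      · rcases hUr with rfl | hUr
        · simpa using hc
        · have := enterCount_submod t h D U W
          have h3 := h1 (U ∪ W) (hW.mono Finset.subset_union_right) (by simp [hUr, hrW])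
          omega
      · right
        simp [hrW]
      · apply Finset.card_lt_card
        refine ⟨Finset.inter_subset_left, fun hh => ?_⟩
        exact hent.2 (Finset.mem_inter.mp (hh htU)).2
    · have : enterCount t h (D.erase e) W + 1 = enterCount t h D W := by
        unfold enterCount
        rw [Finset.filter_erase]
        apply Finset.card_erase_add_one
        simp [heD, hent]
      omega
  · have : enterCount t h (D.erase e) W = enterCount t h D W := by
      unfold enterCount
      rw [Finset.filter_erase, Finset.erase_eq_of_notMem]
      simp only [Finset.mem_filter, not_and]
      intro _
      simpa using hent
    omega

theorem grow_aux {V E : Type*} [Fintype V] [DecidableEq V] [DecidableEq E] (t h : E → V)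
    (r : V) (k : ℕ) (D : Finset E)
    (hD : ∀ U : Finset V, U.Nonempty → r ∉ U → k + 1 ≤ enterCount t h D U) (n : ℕ) :
    ∃ (S : Finset V) (A : Finset E), r ∈ S ∧ (S = Finset.univ ∨ n ≤ S.card) ∧ A ⊆ D ∧
      (∀ e ∈ A, t e ∈ S ∧ h e ∈ S) ∧ (∀ v ∈ S, v ≠ r → ∃ e ∈ A, h e = v) ∧
      (∀ U : Finset V, (U ∩ S).Nonempty → spanCount t h A U + 1 ≤ (U ∩ S).card) ∧
      (∀ U : Finset V, U.Nonempty → r ∉ U → k ≤ enterCount t h (D \ A) U) := by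
  induction n with
  | zero =>
    refine ⟨{r}, ∅, by simp, by simp, by simp, by simp, by simp, ?_, ?_⟩
    · intro U hU
      have := Finset.card_pos.mpr hU
      simp only [spanCount, Finset.filter_empty, Finset.card_empty]
      omega
    · intro U hU hr
      have := hD U hU hr
      rw [Finset.sdiff_empty]
      omega
  | succ n ih =>
    obtain ⟨S, A, hr, hn, hAD, hAS, hin, hsp, hent⟩ := ih
    by_cases hS : S = Finset.univ
    · exact ⟨S, A, hr, Or.inl hS, hAD, hAS, hin, hsp, hent⟩
    have hn' : n ≤ S.card := hn.resolve_left hS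
    obtain ⟨e, heD, het, heh, hek⟩ := grow_step t h r k (D \ A) S hr hS hent (by
      intro U hU hdis
      have h0 := hD U hU (fun hh => Finset.disjoint_left.mp hdis hh hr)
      refine h0.trans (Finset.card_le_card ?_)
      intro e he
      simp only [Finset.mem_filter, Finset.mem_sdiff] at he ⊢
      refine ⟨⟨he.1, fun hA => ?_⟩, he.2⟩
      exact Finset.disjoint_left.mp hdis he.2.1 (hAS e hA).2)
    rw [Finset.mem_sdiff] at heD
    refine ⟨insert (h e) S, insert e A, by simp [hr], Or.inr ?_, ?_, ?_, ?_, ?_, ?_⟩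
    · rw [Finset.card_insert_of_notMem heh]
      omega
    · exact Finset.insert_subset heD.1 hAD
    · intro f hf
      rcases Finset.mem_insert.mp hf with rfl | hf
      · simp [het]
      · simp [hAS f hf]
    · intro v hv hvr
      rcases Finset.mem_insert.mp hv with rfl | hv
      · exact ⟨e, by simp, rfl⟩
      · obtain ⟨f, hf, hfv⟩ := hin v hv hvr
        exact ⟨f, by simp [hf], hfv⟩
    · intro U hU
      have hmono : (U ∩ S).card ≤ (U ∩ insert (h e) S).card :=
        Finset.card_le_card (Finset.inter_subset_inter_left (Finset.subset_insert _ _))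
      by_cases hs : t e ∈ U ∧ h e ∈ U
      · have h3 := hsp U ⟨t e, by simp [hs.1, het]⟩
        have h4 : (U ∩ insert (h e) S).card = (U ∩ S).card + 1 := by
          rw [Finset.inter_insert_of_mem hs.2, Finset.card_insert_of_notMem (by simp [heh])]
        have h5 : spanCount t h (insert e A) U = spanCount t h A U + 1 := by
          unfold spanCount
          rw [Finset.filter_insert, if_pos hs, Finset.card_insert_of_notMem (by simp [heD.2])]
        omega
      · have h5 : spanCount t h (insert e A) U = spanCount t h A U := by
          unfold spanCount
          rw [Finset.filter_insert, if_neg hs]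
        rw [h5]
        by_cases hUS : (U ∩ S).Nonempty
        · have := hsp U hUS
          omega
        · have h6 : spanCount t h A U = 0 := by
            unfold spanCount
            rw [Finset.card_eq_zero, Finset.filter_eq_empty_iff]
            intro f hf hh
            exact hUS ⟨t f, by simp [hh.1, (hAS f hf).1]⟩
          have := Finset.card_pos.mpr hU
          omega
    · have h7 : D \ insert e A = (D \ A).erase e := by
        ext f
        simp only [Finset.mem_sdiff, Finset.mem_insert, Finset.mem_erase]
        tauto
      rw [h7]
      exact hek

theorem grow {V E : Type*} [Fintype V] [DecidableEq V] [DecidableEq E] (t h : E → V)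
    (r : V) (k : ℕ) (D : Finset E)
    (hD : ∀ U : Finset V, U.Nonempty → r ∉ U → k + 1 ≤ enterCount t h D U) :
    ∃ A : Finset E, A ⊆ D ∧ (∀ v, v ≠ r → ∃ e ∈ A, h e = v) ∧
      (∀ U : Finset V, U.Nonempty → spanCount t h A U + 1 ≤ U.card) ∧
      (∀ U : Finset V, U.Nonempty → r ∉ U → k ≤ enterCount t h (D \ A) U) := by
  obtain ⟨S, A, hr, hn, hAD, hAS, hin, hsp, hent⟩ := grow_aux t h r k D hD (Fintype.card V)
  have hS : S = Finset.univ := by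
    rcases hn with hn | hn
    · exact hn
    · exact Finset.eq_univ_of_card S (le_antisymm (Finset.card_le_univ S) hn)
  subst hS
  exact ⟨A, hAD, fun v => hin v (Finset.mem_univ v), fun U hU => by simpa using hsp U (by simpa using hU), hent⟩

/-- Edmonds' disjoint branchings theorem, in counting form. -/
theorem branchings {V E : Type*} [Fintype V] [DecidableEq V] [DecidableEq E] (t h : E → V)
    (r : V) (k : ℕ) : ∀ (D : Finset E)
    (_ : ∀ U : Finset V, U.Nonempty → r ∉ U → k ≤ enterCount t h D U),
    ∃ F : Finset E, F ⊆ D ∧ (∀ v, v ≠ r → k ≤ (F.filter fun e => h e = v).card) ∧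
      (∀ U : Finset V, U.Nonempty → spanCount t h F U + k ≤ k * U.card) := by
  induction k with
  | zero => exact fun D _ => ⟨∅, by simp, by simp, by simp [spanCount]⟩
  | succ k ih =>
    intro D hD
    obtain ⟨A, hAD, hin, hsp, hent⟩ := grow t h r k D hD
    obtain ⟨F, hFD, hFin, hFsp⟩ := ih (D \ A) hent
    have hdis : Disjoint F A := by
      exact Finset.disjoint_of_subset_left hFD Finset.sdiff_disjoint
    refine ⟨F ∪ A, Finset.union_subset (hFD.trans Finset.sdiff_subset) hAD, ?_, ?_⟩
    · intro v hv
      rw [Finset.filter_union, Finset.card_union_of_disjoint (Finset.disjoint_filter_filter hdis)]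
      obtain ⟨e, he, hev⟩ := hin v hv
      have h1 : 0 < (A.filter fun e => h e = v).card :=
        Finset.card_pos.mpr ⟨e, by simp [he, hev]⟩
      have := hFin v hv
      omega
    · intro U hU
      have h1 : spanCount t h (F ∪ A) U = spanCount t h F U + spanCount t h A U := by
        unfold spanCount
        rw [Finset.filter_union, Finset.card_union_of_disjoint (Finset.disjoint_filter_filter hdis)]
      have h2 := hsp U hU
      have h3 := hFsp U hU
      rw [h1]
      linarith [add_mul k 1 U.card]

/-- Orientation with prescribed indegree bounds, by Hall's theorem. -/
theorem exists_orientation {V E : Type*} [Fintype V] [DecidableEq V] [Fintype E]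
    [DecidableEq E] (tail head : E → V) (c : V → ℕ)
    (hc : ∀ U : Finset V, U.Nonempty → spanCount tail head Finset.univ U ≤ ∑ v ∈ U, c v) :
    ∃ h : E → V, (∀ e, h e = tail e ∨ h e = head e) ∧
      ∀ v, (Finset.univ.filter fun e => h e = v).card ≤ c v := by
  classical
  let T : E → Finset (Σ v : V, Fin (c v)) := fun e =>
    ({tail e, head e} : Finset V).sigma fun _ => Finset.univ
  have hall := (Finset.all_card_le_biUnion_card_iff_exists_injective T).mp (by
    intro X
    rcases X.eq_empty_or_nonempty with rfl | hX
    · simp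
    let U : Finset V := X.biUnion fun e => {tail e, head e}
    have hU : U.Nonempty := by
      obtain ⟨e, he⟩ := hX
      exact ⟨tail e, Finset.mem_biUnion.mpr ⟨e, he, by simp⟩⟩
    have h1 : X.card ≤ spanCount tail head Finset.univ U := by
      apply Finset.card_le_card
      intro e he
      simp only [Finset.mem_filter, Finset.mem_univ, true_and]
      exact ⟨Finset.mem_biUnion.mpr ⟨e, he, by simp⟩, Finset.mem_biUnion.mpr ⟨e, he, by simp⟩⟩
    have h2 : X.biUnion T = U.sigma fun _ => Finset.univ := by
      ext ⟨v, i⟩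
      simp only [T, U, Finset.mem_biUnion, Finset.mem_sigma, Finset.mem_univ, and_true]
    rw [h2, Finset.card_sigma]
    simpa using h1.trans (hc U hU))
  obtain ⟨f, hf, hfT⟩ := hall
  refine ⟨fun e => (f e).1, ?_, ?_⟩
  · intro e
    have := hfT e
    simpa [T] using this
  · intro v
    have h1 : (Finset.univ.filter fun e => (f e).1 = v).card
        ≤ (({v} : Finset V).sigma fun v => (Finset.univ : Finset (Fin (c v)))).card := by
      refine Finset.card_le_card_of_injOn f ?_ hf.injOn
      intro e he
      simp at he
      simp [he]
    simpa [Finset.card_sigma] using h1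

/-- Edges spanned by `U` plus edges entering `U` are the edges with head in `U`. -/
theorem span_add_enter {V E : Type*} [DecidableEq V] [DecidableEq E] (t h : E → V)
    (D : Finset E) (U : Finset V) :
    spanCount t h D U + enterCount t h D U = ∑ v ∈ U, (D.filter fun e => h e = v).card := by
  have h1 : ∑ v ∈ U, (D.filter fun e => h e = v).card = (D.filter fun e => h e ∈ U).card := by
    rw [Finset.card_eq_sum_card_fiberwise (f := h) (t := U) (by intro e he; simpa using (Finset.mem_filter.mp (Finset.mem_coe.mp he)).2)]
    · refine Finset.sum_congr rfl fun v hv => ?_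
      congr 1
      ext e
      simp only [Finset.mem_filter]
      constructor
      · rintro ⟨a, rfl⟩; exact ⟨⟨a, hv⟩, rfl⟩
      · rintro ⟨⟨a, _⟩, b⟩; exact ⟨a, b⟩
  rw [h1]
  unfold spanCount enterCount
  simp only [Finset.card_filter, ← Finset.sum_add_distrib]
  refine Finset.sum_congr rfl fun e _ => ?_
  by_cases h1 : h e ∈ U <;> by_cases h2 : t e ∈ U <;> simp [h1, h2]

theorem decompose {V E : Type*} [Fintype V] [DecidableEq V] [Fintype E]
    [DecidableEq E] (tail head : E → V) (a d : ℕ) (r : V)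
    (hE : Fintype.card E + d = (a + d) * Fintype.card V)
    (hs : ∀ U : Finset V, U.Nonempty →
      spanCount tail head Finset.univ U + d ≤ (a + d) * U.card) :
    ∃ F : Finset E, (∀ U : Finset V, U.Nonempty → spanCount tail head F U + d ≤ d * U.card) ∧
      (∀ U : Finset V, spanCount tail head Fᶜ U ≤ a * U.card) := by
  classical
  let c : V → ℕ := fun v => if v = r then a else a + d
  have hcr : ∀ U : Finset V, r ∈ U → ∑ v ∈ U, c v + d = (a + d) * U.card := by
    intro U hU
    rw [← Finset.sum_erase_add _ _ hU]
    have h1 : ∑ v ∈ U.erase r, c v = ∑ v ∈ U.erase r, (a + d) :=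
      Finset.sum_congr rfl fun v hv => by simp [c, (Finset.mem_erase.mp hv).1]
    rw [h1, ← Finset.card_erase_add_one hU]
    simp [c]
    ring
  have hcn : ∀ U : Finset V, r ∉ U → ∑ v ∈ U, c v = (a + d) * U.card := by
    intro U hU
    have h1 : ∑ v ∈ U, c v = ∑ v ∈ U, (a + d) :=
      Finset.sum_congr rfl fun v hv => by
        have : v ≠ r := fun hh => hU (hh ▸ hv)
        simp [c, this]
    rw [h1]
    simp
    ring
  obtain ⟨h, hth, hdeg⟩ := exists_orientation tail head c (by
    intro U hU
    have := hs U hU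
    by_cases hr : r ∈ U
    · have := hcr U hr
      omega
    · have := hcn U hr
      omega)
  let t : E → V := fun e => if h e = tail e then head e else tail e
  have hspan : ∀ F U, spanCount t h F U = spanCount tail head F U := by
    intro F U
    unfold spanCount
    congr 1
    apply Finset.filter_congr
    intro e _
    simp only [t]
    by_cases h1 : h e = tail e
    · simp only [h1, if_true]; tauto
    · have h2 := (hth e).resolve_left h1
      rw [if_neg h1, h2]
  -- all indegree bounds are attained
  have hdeg' : ∀ v, (Finset.univ.filter fun e => h e = v).card = c v := by
    have hsum : ∑ v, (Finset.univ.filter fun e => h e = v).card = ∑ v, c v := by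
      have h1 := hcr Finset.univ (Finset.mem_univ r)
      have h2 : Fintype.card E = ∑ v, (Finset.univ.filter fun e => h e = v).card := by
        rw [← Finset.card_univ]
        exact Finset.card_eq_sum_card_fiberwise (f := h) (t := Finset.univ) (by simp)
      rw [Finset.card_univ] at h1
      omega
    intro v
    exact (Finset.sum_eq_sum_iff_of_le fun v _ => hdeg v).mp hsum v (Finset.mem_univ v)
  obtain ⟨F, -, hFin, hFsp⟩ := branchings t h r d Finset.univ (by
    intro U hU hr
    have h1 := span_add_enter t h Finset.univ U
    simp only [hdeg'] at h1
    rw [hcn U hr, hspan] at h1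
    have := hs U hU
    omega)
  refine ⟨F, fun U hU => hspan F U ▸ hFsp U hU, fun U => ?_⟩
  rw [← hspan]
  have h1 := span_add_enter t h Fᶜ U
  have h2 : ∀ v, (Fᶜ.filter fun e => h e = v).card ≤ a := by
    intro v
    have h3 : (F.filter fun e => h e = v).card + (Fᶜ.filter fun e => h e = v).card = c v := by
      rw [← hdeg' v, ← Finset.card_union_of_disjoint
        (Finset.disjoint_filter_filter disjoint_compl_right), ← Finset.filter_union,
        Finset.union_compl]
    by_cases hv : v = r
    · simp only [c, hv, if_true] at h3 ⊢
      omega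
    · have := hFin v hv
      simp only [c, hv, if_false] at h3
      omega
  have h4 : ∑ v ∈ U, (Fᶜ.filter fun e => h e = v).card ≤ U.card • a :=
    Finset.sum_le_card_nsmul _ _ _ fun v _ => h2 v
  rw [smul_eq_mul, mul_comm] at h4
  omega

theorem stmt_17 {d : ℕ} (hd : 1 ≤ d) {V E : Type*} [Fintype V] [DecidableEq V]
    [Fintype E] [DecidableEq E] (tail head : E → V)
    (hE : (Fintype.card E : ℤ) = (d + 1).choose 2 * Fintype.card V - d) :
    Sparse tail head ((d + 1).choose 2) (-(d : ℤ)) Finset.univ ↔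
      ∃ F₁ F₂ : Finset E, Disjoint F₁ F₂ ∧ F₁ ∪ F₂ = Finset.univ ∧
        Tight tail head d (-(d : ℤ)) F₁ ∧
        Tight tail head (d.choose 2) 0 F₂ := by
  have hk : (d + 1).choose 2 = d.choose 2 + d := by
    rw [Nat.choose_succ_succ' d 1, Nat.choose_one_right, add_comm]
  rw [hk] at hE ⊢
  generalize d.choose 2 = a at *
  constructor
  · intro hs
    have hV : Nonempty V := by
      by_contra hV
      rw [not_nonempty_iff] at hV
      rw [Fintype.card_eq_zero (α := V)] at hE
      simp at hE
      omega
    obtain ⟨r⟩ := hV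
    obtain ⟨F, hF1, hF2⟩ := decompose tail head a d r (by zify; push_cast at hE; linarith) (by
      intro U hU
      have := hs U hU
      unfold spanCount
      zify
      push_cast at this
      linarith)
    have hs1 : Sparse tail head d (-(d : ℤ)) F := by
      intro U hU
      have := hF1 U hU
      unfold spanCount at this
      zify at this
      linarith
    have hs2 : Sparse tail head a 0 Fᶜ := by
      intro U hU
      have := hF2 U
      unfold spanCount at this
      zify at this
      linarith
    have c1 := hs1 Finset.univ ⟨r, Finset.mem_univ r⟩
    have c2 := hs2 Finset.univ ⟨r, Finset.mem_univ r⟩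
    have c3 : (F.card : ℤ) + (Fᶜ.card : ℤ) = Fintype.card E := by
      exact_mod_cast Finset.card_add_card_compl F
    simp only [Finset.mem_univ, and_self, Finset.filter_true, Finset.card_univ] at c1 c2
    push_cast at hE
    refine ⟨F, Fᶜ, disjoint_compl_right, Finset.union_compl F, ⟨hs1, ?_⟩, ⟨hs2, ?_⟩⟩
    · linarith
    · linarith
  · rintro ⟨F₁, F₂, hdis, hun, ⟨h1, -⟩, ⟨h2, -⟩⟩ U hU
    have c1 := h1 U hU
    have c2 := h2 U hU
    rw [← hun, Finset.filter_union,
      Finset.card_union_of_disjoint (Finset.disjoint_filter_filter hdis)]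
    push_cast
    linarith
end
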